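/- arXiv:1807.09903 — 7 statements merged into one kernel-verified Lean document; each statement's English description precedes it below -/
import Mathlib

section
/- Let D, D' ⊆ ℂ be open sets, g holomorphic on D, f holomorphic on D', and S holomorphic on D with S(D) ⊆ D'. Let q and ψ be holomorphic on D with q(z)² = S'(z) and g'(z) − f'(S(z))·S'(z) = i·ψ(z)·q(z) for all z ∈ D. Let z₀ ∈ D, w₀ ∈ D', and ζ₀ ∈ D with S(ζ₀) = w₀, and assume the straight segment [ζ₀, z₀] is contained in D. Then (g(z₀) + f(w₀)) − (g(ζ₀) + f(S(z₀))) = i · ∫_{[ζ₀,z₀]} ψ(z)·q(z) dz. -/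
open Complex

/-- Complex contour integral along the straight segment from `p` to `q`. -/
noncomputable def segIntegral (f : ℂ → ℂ) (p q : ℂ) : ℂ :=
  (q - p) * ∫ t in (0:ℝ)..1, f (p + (t : ℂ) * (q - p))

/-- Complexified nonhomogeneous Neumann reflection formula (Lemma 1):
for `u(z,w) = g(z) + f(w)` solving the complexified Laplace equation near the
complexified curve `{w = S(z)}`, with `q` a holomorphic branch of `√(S')` and
`ψ` the holomorphically continued Neumann datum,
`u(z₀,w₀) − u(S̃(w₀), S(z₀)) = i ∫_{S̃(w₀)}^{z₀} ψ(z) √(S'(z)) dz`. -/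
theorem neumann_reflection_laplace
    (D D' : Set ℂ) (hD : IsOpen D) (hD' : IsOpen D')
    (g f S q ψ : ℂ → ℂ)
    (hg : DifferentiableOn ℂ g D) (hf : DifferentiableOn ℂ f D')
    (hS : DifferentiableOn ℂ S D) (hSD : S '' D ⊆ D')
    (hq : DifferentiableOn ℂ q D) (hψ : DifferentiableOn ℂ ψ D)
    (hq2 : ∀ z ∈ D, (q z) ^ 2 = deriv S z)
    (hneu : ∀ z ∈ D, deriv g z - deriv f (S z) * deriv S z = I * ψ z * q z)
    (z₀ : ℂ) (hz₀ : z₀ ∈ D) (w₀ : ℂ) (hw₀ : w₀ ∈ D')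
    (ζ₀ : ℂ) (hζ₀ : ζ₀ ∈ D) (hSζ₀ : S ζ₀ = w₀)
    (hseg : segment ℝ ζ₀ z₀ ⊆ D) :
    (g z₀ + f w₀) - (g ζ₀ + f (S z₀)) =
      I * segIntegral (fun z => ψ z * q z) ζ₀ z₀ := by
  have hγD : ∀ t ∈ Set.uIcc (0:ℝ) 1, ζ₀ + (t : ℂ) * (z₀ - ζ₀) ∈ D := by
    intro t ht
    rw [Set.uIcc_of_le zero_le_one] at ht
    apply hseg
    rw [segment_eq_image']
    exact ⟨t, ht, by simp⟩
  have hγ : ∀ t : ℝ, HasDerivAt (fun t : ℝ => ζ₀ + (t : ℂ) * (z₀ - ζ₀)) (z₀ - ζ₀) t := by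
    intro t
    simpa using ((Complex.ofRealCLM.hasDerivAt (x := t)).mul_const (z₀ - ζ₀)).const_add ζ₀
  have hF : ∀ z ∈ D, HasDerivAt (fun z => g z - f (S z)) (I * ψ z * q z) z := by
    intro z hz
    rw [← hneu z hz]
    have h1 := (hg.differentiableAt (hD.mem_nhds hz)).hasDerivAt
    have h2 := (hS.differentiableAt (hD.mem_nhds hz)).hasDerivAt
    have h3 := (hf.differentiableAt (hD'.mem_nhds (hSD ⟨z, hz, rfl⟩))).hasDerivAt
    exact h1.sub (h3.comp z h2)
  have hcont : ContinuousOn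
      (fun t : ℝ => I * ψ (ζ₀ + (t : ℂ) * (z₀ - ζ₀)) * q (ζ₀ + (t : ℂ) * (z₀ - ζ₀)) * (z₀ - ζ₀))
      (Set.uIcc 0 1) := by
    have hc : ContinuousOn (fun t : ℝ => ζ₀ + (t : ℂ) * (z₀ - ζ₀)) (Set.uIcc 0 1) := by
      fun_prop
    exact ((continuousOn_const.mul (hψ.continuousOn.comp hc hγD)).mul
      (hq.continuousOn.comp hc hγD)).mul continuousOn_const
  have key := intervalIntegral.integral_eq_sub_of_hasDerivAt
    (fun t ht => (hF _ (hγD t ht)).comp t (hγ t)) hcont.intervalIntegrable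
  simp only [Function.comp_def, Complex.ofReal_one, Complex.ofReal_zero, one_mul, zero_mul,
    add_zero, add_sub_cancel, hSζ₀] at key
  have e : (g z₀ + f w₀) - (g ζ₀ + f (S z₀)) = g z₀ - f (S z₀) - (g ζ₀ - f w₀) := by ring
  rw [e, ← key, segIntegral, ← mul_assoc, ← intervalIntegral.integral_const_mul]
  congr 1
  funext t
  ring
end

section
/- Let D, D' ⊆ ℂ be open sets, g holomorphic on D, f holomorphic on D', and S holomorphic on D with S(D) ⊆ D'. Let q and ψ be holomorphic on D with q(z)² = S'(z) and g'(z) − f'(S(z))·S'(z) = i·ψ(z)·q(z) for all z ∈ D. Let z₀ ∈ D, w₀ ∈ D', and ζ₀ ∈ D with S(ζ₀) = w₀, and assume the straight segment [ζ₀, z₀] is contained in D. Then g(z₀) + f(w₀) = ½·[(g(ζ₀) + f(w₀)) + (g(z₀) + f(S(z₀)))] + (i/2) · ∫_{[ζ₀,z₀]} ψ(z)·q(z) dz. -/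
open Complex

/-- Theorem 1 (representation of solutions of the Cauchy problem for the
complexified Laplace equation): for `u(z,w) = g(z) + f(w)`, `S` the Schwarz
function of the curve `{w = S(z)}`, `ζ₀ = S̃(w₀)`, `q` a branch of `√(S')`,
`u(z₀,w₀) = ½[u(S̃(w₀),w₀) + u(z₀,S(z₀))] + (i/2)∫_{S̃(w₀)}^{z₀} ψ √(S') dz`. -/
theorem cauchy_representation_laplace
    (D D' : Set ℂ) (hD : IsOpen D) (hD' : IsOpen D')
    (g f S q ψ : ℂ → ℂ)
    (hg : DifferentiableOn ℂ g D) (hf : DifferentiableOn ℂ f D')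
    (hS : DifferentiableOn ℂ S D) (hSD : S '' D ⊆ D')
    (hq : DifferentiableOn ℂ q D) (hψ : DifferentiableOn ℂ ψ D)
    (hq2 : ∀ z ∈ D, (q z) ^ 2 = deriv S z)
    (hneu : ∀ z ∈ D, deriv g z - deriv f (S z) * deriv S z = I * ψ z * q z)
    (z₀ : ℂ) (hz₀ : z₀ ∈ D) (w₀ : ℂ) (hw₀ : w₀ ∈ D')
    (ζ₀ : ℂ) (hζ₀ : ζ₀ ∈ D) (hSζ₀ : S ζ₀ = w₀)
    (hseg : segment ℝ ζ₀ z₀ ⊆ D) :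
    g z₀ + f w₀ =
      (1/2) * ((g ζ₀ + f w₀) + (g z₀ + f (S z₀)))
        + (I/2) * segIntegral (fun z => ψ z * q z) ζ₀ z₀ := by
  have hmem : ∀ t ∈ Set.uIcc (0:ℝ) 1, ζ₀ + (t : ℂ) * (z₀ - ζ₀) ∈ D := by
    intro t ht
    rw [Set.uIcc_of_le zero_le_one] at ht
    apply hseg
    rw [segment_eq_image']
    exact ⟨t, ht, by simp⟩
  have hline : ∀ t : ℝ, HasDerivAt (fun t : ℝ => ζ₀ + (t : ℂ) * (z₀ - ζ₀)) (z₀ - ζ₀) t := by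
    intro t
    simpa using ((Complex.ofRealCLM.hasDerivAt (x := t)).mul_const (z₀ - ζ₀)).const_add ζ₀
  have hprim : ∀ z ∈ D, HasDerivAt (fun z => g z - f (S z)) (I * ψ z * q z) z := by
    intro z hz
    rw [← hneu z hz]
    have h1 := (hg.differentiableAt (hD.mem_nhds hz)).hasDerivAt
    have h2 := (hS.differentiableAt (hD.mem_nhds hz)).hasDerivAt
    have h3 := (hf.differentiableAt
      (hD'.mem_nhds (hSD (Set.mem_image_of_mem S hz)))).hasDerivAt
    exact h1.sub (h3.comp z h2)
  have hcont : ContinuousOn (fun t : ℝ => I * ψ (ζ₀ + (t : ℂ) * (z₀ - ζ₀))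
      * q (ζ₀ + (t : ℂ) * (z₀ - ζ₀)) * (z₀ - ζ₀)) (Set.uIcc (0:ℝ) 1) := by
    have hl : ContinuousOn (fun t : ℝ => ζ₀ + (t : ℂ) * (z₀ - ζ₀)) (Set.uIcc (0:ℝ) 1) := by
      fun_prop
    have h1 := hψ.continuousOn.comp hl hmem
    have h2 := hq.continuousOn.comp hl hmem
    exact ((continuousOn_const.mul h1).mul h2).mul continuousOn_const
  have hftc := intervalIntegral.integral_eq_sub_of_hasDerivAt
    (fun t ht => (hprim _ (hmem t ht)).comp t (hline t)) hcont.intervalIntegrable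
  have hint : I * segIntegral (fun z => ψ z * q z) ζ₀ z₀ =
      (g z₀ - f (S z₀)) - (g ζ₀ - f w₀) := by
    have e : ∀ t : ℝ, I * ψ (ζ₀ + (t : ℂ) * (z₀ - ζ₀)) * q (ζ₀ + (t : ℂ) * (z₀ - ζ₀)) * (z₀ - ζ₀)
        = (I * (z₀ - ζ₀)) * (ψ (ζ₀ + (t : ℂ) * (z₀ - ζ₀)) * q (ζ₀ + (t : ℂ) * (z₀ - ζ₀))) := by
      intro t; ring
    simp only [e, intervalIntegral.integral_const_mul] at hftc
    rw [segIntegral, ← mul_assoc, hftc]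
    simp [hSζ₀]
  linear_combination (-1/2) * hint
end

section
/- Let Ω ⊆ ℂ be open, connected, symmetric under complex conjugation, with Ω ∩ ℝ ≠ ∅. Let F be holomorphic on Ω and set u := Re F. Suppose Ψ is holomorphic on Ω and, for every real x ∈ Ω, Ψ(x) equals the derivative at t = 0 of the map t ↦ u(x + i·t) (the normal derivative of u on the real axis). Then for every z ∈ Ω such that the straight segment [conj z, z] is contained in Ω: u(z) − u(conj z) = −i · ∫_{[conj z, z]} Ψ(ζ) dζ. -/
open Complex

/-- Nonhomogeneous Neumann reflection formula (Lemma 1) specialized to the real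
axis: if `u = Re F` is harmonic on a conjugation-symmetric domain `Ω` meeting
the real axis and `Ψ` is the holomorphic continuation of the Neumann datum
`∂u/∂y` on the axis, then `u(z) − u(conj z) = −i ∫_{conj z}^{z} Ψ(ζ) dζ`. -/
theorem neumann_reflection_real_axis
    (Ω : Set ℂ) (hΩ : IsOpen Ω) (hconn : IsConnected Ω)
    (hsym : ∀ z ∈ Ω, (starRingEnd ℂ) z ∈ Ω)
    (hreal : ∃ x : ℝ, (x : ℂ) ∈ Ω)
    (F Ψ : ℂ → ℂ)
    (hF : DifferentiableOn ℂ F Ω)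
    (hΨ : DifferentiableOn ℂ Ψ Ω)
    (hbd : ∀ x : ℝ, (x : ℂ) ∈ Ω →
      Ψ (x : ℂ) = ((deriv (fun t : ℝ => (F ((x : ℂ) + (t : ℂ) * I)).re) 0 : ℝ) : ℂ)) :
    ∀ z ∈ Ω, segment ℝ ((starRingEnd ℂ) z) z ⊆ Ω →
      ((F z).re : ℂ) - ((F ((starRingEnd ℂ) z)).re : ℂ) =
        -I * segIntegral Ψ ((starRingEnd ℂ) z) z := by
  classical
  have hcomm : ∀ w ∈ Ω, HasDerivAt (fun w => I / 2 * (F w - (starRingEnd ℂ) (F ((starRingEnd ℂ) w))))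
      (I / 2 * (deriv F w - (starRingEnd ℂ) (deriv F ((starRingEnd ℂ) w)))) w := by
    intro w hw
    have h1 : HasDerivAt F (deriv F w) w :=
      (hF.differentiableAt (hΩ.mem_nhds hw)).hasDerivAt
    have h2 : HasDerivAt F (deriv F ((starRingEnd ℂ) w)) ((starRingEnd ℂ) w) :=
      (hF.differentiableAt (hΩ.mem_nhds (hsym w hw))).hasDerivAt
    have h3 := h2.conj_conj
    rw [Complex.conj_conj] at h3
    exact (h1.sub h3).const_mul (I / 2)
  have hHd : DifferentiableOn ℂ
      (fun w => I / 2 * (F w - (starRingEnd ℂ) (F ((starRingEnd ℂ) w)))) Ω :=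
    fun w hw => (hcomm w hw).differentiableAt.differentiableWithinAt
  have hreal_eq : ∀ x : ℝ, (x : ℂ) ∈ Ω → Ψ x =
      deriv (fun w => I / 2 * (F w - (starRingEnd ℂ) (F ((starRingEnd ℂ) w)))) x := by
    intro x hx
    rw [(hcomm x hx).deriv, hbd x hx, Complex.conj_ofReal]
    have h1 : HasDerivAt F (deriv F x) x :=
      (hF.differentiableAt (hΩ.mem_nhds hx)).hasDerivAt
    have hline : HasDerivAt (fun t : ℝ => (x : ℂ) + (t : ℂ) * I) I 0 := by
      have := ((Complex.ofRealCLM.hasDerivAt (x := (0:ℝ))).mul_const I).const_add (x : ℂ)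
      simpa using this
    have h2 : HasDerivAt (fun t : ℝ => F ((x : ℂ) + (t : ℂ) * I)) (deriv F x * I) 0 := by
      refine HasDerivAt.comp (h₂ := F) (0:ℝ) ?_ hline
      simpa using h1
    have h3 : HasDerivAt (fun t : ℝ => (F ((x : ℂ) + (t : ℂ) * I)).re) (deriv F x * I).re 0 :=
      (Complex.reCLM.hasFDerivAt.comp_hasDerivAt (0:ℝ) h2)
    rw [h3.deriv]
    apply Complex.ext <;> simp
    ring
  have hEq : Set.EqOn Ψ
      (deriv (fun w => I / 2 * (F w - (starRingEnd ℂ) (F ((starRingEnd ℂ) w))))) Ω := by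
    obtain ⟨x, hx⟩ := hreal
    refine AnalyticOnNhd.eqOn_of_preconnected_of_frequently_eq (hΨ.analyticOnNhd hΩ)
      ((hHd.analyticOnNhd hΩ).deriv) hconn.isPreconnected hx ?_
    have ht : Filter.Tendsto (fun y : ℝ => (y : ℂ)) (nhdsWithin x {x}ᶜ)
        (nhdsWithin (x : ℂ) {(x : ℂ)}ᶜ) := by
      exact Complex.continuous_ofReal.continuousAt.continuousWithinAt.tendsto_nhdsWithin
        (fun y hy => by simpa using hy)
    refine ht.frequently (Filter.Eventually.frequently ?_)
    have : ∀ᶠ y : ℝ in nhds x, (y : ℂ) ∈ Ω :=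
      Complex.continuous_ofReal.continuousAt.eventually (hΩ.mem_nhds hx)
    exact (this.filter_mono nhdsWithin_le_nhds).mono fun y hy => hreal_eq y hy
  intro z hz hseg
  set p := (starRingEnd ℂ) z with hp
  have hmem : ∀ t ∈ Set.uIcc (0:ℝ) 1, p + (t : ℂ) * (z - p) ∈ Ω := by
    intro t ht
    rw [Set.uIcc_of_le zero_le_one] at ht
    apply hseg
    rw [segment_eq_image']
    exact ⟨t, ht, by simp⟩
  have hline : ∀ t : ℝ, HasDerivAt (fun t : ℝ => p + (t : ℂ) * (z - p)) (z - p) t := by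
    intro t
    have := ((Complex.ofRealCLM.hasDerivAt (x := t)).mul_const (z - p)).const_add p
    simpa using this
  have hint : ∫ t in (0:ℝ)..1, Ψ (p + (t : ℂ) * (z - p)) * (z - p) =
      (I / 2 * (F z - (starRingEnd ℂ) (F ((starRingEnd ℂ) z)))) -
      (I / 2 * (F p - (starRingEnd ℂ) (F ((starRingEnd ℂ) p)))) := by
    have := intervalIntegral.integral_eq_sub_of_hasDerivAt (a := 0) (b := 1)
      (f := fun t : ℝ => (fun w => I / 2 * (F w - (starRingEnd ℂ) (F ((starRingEnd ℂ) w))))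
        (p + (t : ℂ) * (z - p)))
      (f' := fun t : ℝ => Ψ (p + (t : ℂ) * (z - p)) * (z - p)) ?_ ?_
    · rw [this]; simp
    · intro t ht
      have hw := hmem t ht
      have h1 := (hcomm _ hw).differentiableAt.hasDerivAt
      rw [← hEq hw] at h1
      exact HasDerivAt.comp (h := fun t : ℝ => p + (t : ℂ) * (z - p))
        (h₂ := fun w => I / 2 * (F w - (starRingEnd ℂ) (F ((starRingEnd ℂ) w)))) t h1 (hline t)
    · apply ContinuousOn.intervalIntegrable
      refine ContinuousOn.mul ?_ continuousOn_const
      exact hΨ.continuousOn.comp (by fun_prop) hmem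
  rw [intervalIntegral.integral_mul_const] at hint
  rw [segIntegral, mul_comm (z - p), hint, hp, Complex.conj_conj]
  apply Complex.ext <;> simp <;> ring
end

section
/- Let Ω ⊆ ℂ be open, connected, symmetric under complex conjugation, with Ω ∩ ℝ ≠ ∅. Let F be holomorphic on Ω, set u := Re F, and let α ∈ ℝ. Suppose that for every real x ∈ Ω the derivative at t = 0 of the map t ↦ u(x + i·t) equals α. Then for every z ∈ Ω: u(z) = u(conj z) + 2·α·Im z. -/
open Complex

/-- Example 1 of the paper: a harmonic function `u = Re F` near the real axis
whose normal derivative `∂u/∂y` equals the constant `α` on the axis satisfies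
the reflection formula `u(x₀,y₀) = u(x₀,−y₀) + 2α y₀`. -/
theorem example_reflection_constant_neumann
    (Ω : Set ℂ) (hΩ : IsOpen Ω) (hconn : IsConnected Ω)
    (hsym : ∀ z ∈ Ω, (starRingEnd ℂ) z ∈ Ω)
    (hreal : ∃ x : ℝ, (x : ℂ) ∈ Ω)
    (F : ℂ → ℂ) (hF : DifferentiableOn ℂ F Ω)
    (α : ℝ)
    (hneu : ∀ x : ℝ, (x : ℂ) ∈ Ω →
      deriv (fun t : ℝ => (F ((x : ℂ) + (t : ℂ) * I)).re) 0 = α) :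
    ∀ z ∈ Ω, (F z).re = (F ((starRingEnd ℂ) z)).re + 2 * α * z.im := by
  obtain ⟨x0, hx0⟩ := hreal
  have hd : ∀ z ∈ Ω, DifferentiableAt ℂ F z := fun z hz =>
    hF.differentiableAt (hΩ.mem_nhds hz)
  let G : ℂ → ℂ := fun z =>
    F z - ((starRingEnd ℂ) ∘ F ∘ (starRingEnd ℂ)) z + 2 * α * I * z
  have hGd : ∀ z ∈ Ω, HasDerivAt G
      (deriv F z - (starRingEnd ℂ) (deriv F ((starRingEnd ℂ) z)) + 2 * α * I) z := by
    intro z hz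
    have h1 := (hd z hz).hasDerivAt
    have h2 := (hd _ (hsym z hz)).hasDerivAt.conj_conj
    rw [Complex.conj_conj] at h2
    have h3 := (hasDerivAt_id z).const_mul (2 * (α : ℂ) * I)
    rw [mul_one] at h3
    exact (h1.sub h2).add h3
  have hG : DifferentiableOn ℂ G Ω := fun z hz =>
    (hGd z hz).differentiableAt.differentiableWithinAt
  have hreal0 : ∀ x : ℝ, (x : ℂ) ∈ Ω → deriv G x = 0 := by
    intro x hx
    rw [(hGd x hx).deriv, Complex.conj_ofReal]
    have h1 : HasDerivAt (fun t : ℝ => (x : ℂ) + (t : ℂ) * I) I 0 := by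
      simpa using ((Complex.ofRealCLM.hasDerivAt (x := (0 : ℝ))).mul_const I).const_add (x : ℂ)
    have h2 : HasDerivAt F (deriv F x) ((x : ℂ) + ((0 : ℝ) : ℂ) * I) := by
      simpa using (hd x hx).hasDerivAt
    have h3 := h2.comp (0 : ℝ) h1
    have h4 : HasDerivAt (fun t : ℝ => (F ((x : ℂ) + (t : ℂ) * I)).re)
        (deriv F x * I).re 0 :=
      Complex.reCLM.hasFDerivAt.comp_hasDerivAt (0 : ℝ) h3
    have h5 := hneu x hx
    rw [h4.deriv] at h5
    simp at h5
    apply Complex.ext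
    · simp
    · simp
      linarith
  have hGa : AnalyticOnNhd ℂ (deriv G) Ω := (hG.analyticOnNhd hΩ).deriv
  have hfreq : ∃ᶠ z in nhdsWithin (x0 : ℂ) {(x0 : ℂ)}ᶜ, deriv G z = 0 := by
    have ht : Filter.Tendsto (fun x : ℝ => (x : ℂ)) (nhdsWithin x0 {x0}ᶜ)
        (nhdsWithin (x0 : ℂ) {(x0 : ℂ)}ᶜ) :=
      (Complex.continuous_ofReal.continuousAt.continuousWithinAt).tendsto_nhdsWithin
        (fun x hx => by simpa using hx)
    have hev : ∀ᶠ x : ℝ in nhdsWithin x0 {x0}ᶜ, deriv G (x : ℂ) = 0 := by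
      have : ∀ᶠ x : ℝ in nhds x0, (x : ℂ) ∈ Ω :=
        Complex.continuous_ofReal.continuousAt.eventually (hΩ.mem_nhds hx0)
      exact (this.filter_mono nhdsWithin_le_nhds).mono hreal0
    exact ht.frequently hev.frequently
  have hzero := hGa.eqOn_zero_of_preconnected_of_frequently_eq_zero
    hconn.isPreconnected hx0 hfreq
  intro z hz
  have hc : G z = G x0 :=
    hΩ.is_const_of_deriv_eq_zero hconn.isPreconnected hG hzero hz hx0
  have hre := congrArg Complex.re hc
  simp [G] at hre
  linarith
end

section
/- Let D, D' ⊆ ℂ be open sets, g holomorphic on D, f holomorphic on D', and S holomorphic on D with S(D) ⊆ D'. Let k > 0 and let T be holomorphic on D with g'(z) − f'(S(z))·S'(z) = −T(z)/(2k) for all z ∈ D. Let z₀ ∈ D, w₀ ∈ D', and ζ₀ ∈ D with S(ζ₀) = w₀, and assume the straight segment [ζ₀, z₀] is contained in D. Then g(z₀) + f(w₀) = ½·[(g(ζ₀) + f(w₀)) + (g(z₀) + f(S(z₀)))] − (1/(4k)) · ∫_{[ζ₀,z₀]} T(z) dz. -/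
open Complex

/-- The Hele-Shaw representation formula (p_0): the pressure
`u(z,w) = g(z) + f(w)` solving the complexified Laplace equation near the free
boundary `{w = S(z)}`, with kinematic condition `g' − f'(S)S' = −T/(2k)`
(`T = Ṡ` the time derivative of the Schwarz function), satisfies
`u(z₀,w₀) = ½[u(S̃(w₀),w₀) + u(z₀,S(z₀))] − (1/(4k)) ∫_{S̃(w₀)}^{z₀} T dz`. -/
theorem hele_shaw_representation
    (D D' : Set ℂ) (hD : IsOpen D) (hD' : IsOpen D')
    (g f S T : ℂ → ℂ) (k : ℝ) (hk : 0 < k)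
    (hg : DifferentiableOn ℂ g D) (hf : DifferentiableOn ℂ f D')
    (hS : DifferentiableOn ℂ S D) (hSD : S '' D ⊆ D')
    (hT : DifferentiableOn ℂ T D)
    (hneu : ∀ z ∈ D, deriv g z - deriv f (S z) * deriv S z = -T z / (2 * (k : ℂ)))
    (z₀ : ℂ) (hz₀ : z₀ ∈ D) (w₀ : ℂ) (hw₀ : w₀ ∈ D')
    (ζ₀ : ℂ) (hζ₀ : ζ₀ ∈ D) (hSζ₀ : S ζ₀ = w₀)
    (hseg : segment ℝ ζ₀ z₀ ⊆ D) :
    g z₀ + f w₀ =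
      (1/2) * ((g ζ₀ + f w₀) + (g z₀ + f (S z₀)))
        - (1 / (4 * (k : ℂ))) * segIntegral T ζ₀ z₀ := by
  have hk' : (k : ℂ) ≠ 0 := by exact_mod_cast hk.ne'
  have hmem : ∀ t ∈ Set.uIcc (0:ℝ) 1, ζ₀ + (t : ℂ) * (z₀ - ζ₀) ∈ D := by
    intro t ht
    rw [Set.uIcc_of_le zero_le_one] at ht
    apply hseg
    rw [segment_eq_image']
    exact ⟨t, ht, by simp⟩
  have hG : ∀ z ∈ D, HasDerivAt (fun z => g z - f (S z)) (-T z / (2 * (k : ℂ))) z := by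
    intro z hz
    have h1 := (hg.differentiableAt (hD.mem_nhds hz)).hasDerivAt
    have h2 := (hS.differentiableAt (hD.mem_nhds hz)).hasDerivAt
    have h3 := (hf.differentiableAt (hD'.mem_nhds (hSD ⟨z, hz, rfl⟩))).hasDerivAt
    rw [← hneu z hz]
    exact h1.sub (h3.comp z h2)
  have hγ : ∀ t : ℝ, HasDerivAt (fun t : ℝ => ζ₀ + (t : ℂ) * (z₀ - ζ₀)) (z₀ - ζ₀) t := by
    intro t
    simpa using ((Complex.ofRealCLM.hasDerivAt (x := t)).mul_const (z₀ - ζ₀)).const_add ζ₀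
  have hcont : ContinuousOn (fun t : ℝ => T (ζ₀ + (t : ℂ) * (z₀ - ζ₀))) (Set.uIcc 0 1) :=
    hT.continuousOn.comp (fun t _ => (hγ t).continuousAt.continuousWithinAt) hmem
  have key := intervalIntegral.integral_eq_sub_of_hasDerivAt
    (fun t ht => (hG _ (hmem t ht)).comp t (hγ t))
    (((hcont.neg.div_const (2 * (k : ℂ))).mul_const (z₀ - ζ₀)).intervalIntegrable)
  simp only [Function.comp, intervalIntegral.integral_mul_const,
    intervalIntegral.integral_div, intervalIntegral.integral_neg] at key
  simp only [ofReal_one, ofReal_zero, one_mul, zero_mul, add_zero, add_sub_cancel, hSζ₀] at key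
  unfold segIntegral
  generalize (∫ t in (0:ℝ)..1, T (ζ₀ + (t : ℂ) * (z₀ - ζ₀))) = I at key ⊢
  field_simp at key ⊢
  linear_combination (-2 : ℂ) * key
end

section
/- Let λ ∈ ℝ and let Ω ⊆ ℂ be open, connected, symmetric under complex conjugation, with Ω ∩ ℝ ≠ ∅. Let u : ℂ → ℝ be twice continuously differentiable on Ω with Δu + λ²·u = 0 on Ω, and suppose u(x) = 0 for every real x ∈ Ω. Then u(conj z) = −u(z) for every z ∈ Ω. -/
open Complex

/-- Partial derivative in the `x`-direction of a function of a complex variable. -/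
noncomputable def dx (u : ℂ → ℝ) (z : ℂ) : ℝ :=
  deriv (fun t : ℝ => u (z + (t : ℂ))) 0

/-- Partial derivative in the `y`-direction of a function of a complex variable. -/
noncomputable def dy (u : ℂ → ℝ) (z : ℂ) : ℝ :=
  deriv (fun t : ℝ => u (z + (t : ℂ) * I)) 0

/-- The Laplacian `∂²u/∂x² + ∂²u/∂y²`. -/
noncomputable def lap (u : ℂ → ℝ) (z : ℂ) : ℝ :=
  dx (dx u) z + dy (dy u) z

open Set Metric Filter Topology MeasureTheory

/-- Fourier character. -/
noncomputable def chE (m : ℤ) (θ : ℝ) : ℂ := Complex.exp (-(m : ℂ) * θ * I)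

lemma chE_hasDerivAt (m : ℤ) (θ : ℝ) : HasDerivAt (chE m) (chE m θ * (-(m : ℂ) * I)) θ := by
  unfold chE
  have h : HasDerivAt (fun x : ℝ => -(m : ℂ) * x * I) (-(m : ℂ) * I) θ := by
    simpa using ((Complex.ofRealCLM.hasDerivAt (x := θ)).const_mul (-(m : ℂ))).mul_const I
  exact h.cexp

lemma chE_cont (m : ℤ) : Continuous (chE m) := by unfold chE; fun_prop

lemma chE_norm (m : ℤ) (θ : ℝ) : ‖chE m θ‖ = 1 := by
  have : -(m : ℂ) * θ * I = ((-(m : ℝ) * θ : ℝ) : ℂ) * I := by push_cast; ring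
  rw [chE, this, Complex.norm_exp_ofReal_mul_I]

lemma chE_zero (m : ℤ) : chE m 0 = 1 := by simp [chE]

lemma chE_two_pi (m : ℤ) : chE m (2 * Real.pi) = 1 := by
  unfold chE
  rw [Complex.exp_eq_one_iff]
  exact ⟨-m, by push_cast; ring⟩

lemma chE_shift (m : ℤ) (θ : ℝ) : Complex.exp (θ * I) * chE m θ = chE (m - 1) θ := by
  unfold chE
  rw [← Complex.exp_add]; congr 1; push_cast; ring

lemma chE_shift' (m : ℤ) (θ : ℝ) : Complex.exp (-(θ * I)) * chE (m - 1) θ = chE m θ := by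
  unfold chE
  rw [← Complex.exp_add]; congr 1; push_cast; ring

lemma circle_mem {c : ℂ} {r R : ℝ} (h0 : 0 ≤ r) (hr : r < R) (θ : ℝ) :
    circleMap c r θ ∈ ball c R :=
  closedBall_subset_ball hr (circleMap_mem_closedBall c h0 θ)

lemma circle_cont_comp {E : Type*} [TopologicalSpace E] {g : ℂ → E} {c : ℂ} {r R : ℝ}
    (hg : ContinuousOn g (ball c R)) (h0 : 0 ≤ r) (hr : r < R) :
    Continuous (fun θ => g (circleMap c r θ)) := by
  rw [← continuousOn_univ]
  exact hg.comp (continuous_circleMap c r).continuousOn (fun θ _ => circle_mem h0 hr θ)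

lemma diffAt_of {g : ℂ → ℂ} {S : Set ℂ} (hS : IsOpen S) (hg : ContDiffOn ℝ 1 g S) {z : ℂ}
    (hz : z ∈ S) : DifferentiableAt ℝ g z :=
  (hg.differentiableOn one_ne_zero).differentiableAt (hS.mem_nhds hz)

lemma fd_cont {g : ℂ → ℂ} {S : Set ℂ} (hS : IsOpen S) (hg : ContDiffOn ℝ 1 g S) :
    ContinuousOn (fderiv ℝ g) S := hg.continuousOn_fderiv_of_isOpen hS le_rfl

lemma coef_hasDerivAt {g : ℂ → ℂ} {c : ℂ} {r R : ℝ} (hg : ContDiffOn ℝ 1 g (ball c R))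
    (h0 : 0 < r) (hr : r < R) (m : ℤ) :
    HasDerivAt (fun s : ℝ => ∫ θ in (0:ℝ)..(2 * Real.pi), g (circleMap c s θ) * chE m θ)
      (∫ θ in (0:ℝ)..(2 * Real.pi),
        fderiv ℝ g (circleMap c r θ) (Complex.exp (θ * I)) * chE m θ) r := by
  obtain ⟨r', hr1, hr2⟩ := exists_between hr
  have hcF := fd_cont isOpen_ball hg
  obtain ⟨M, hM⟩ := (isCompact_closedBall c r').exists_bound_of_continuousOn
    (hcF.mono (closedBall_subset_ball hr2))
  have hmem : ∀ s ∈ Ioo 0 r', ∀ θ, circleMap c s θ ∈ closedBall c r' := fun s hs θ =>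
    closedBall_subset_closedBall hs.2.le (circleMap_mem_closedBall c hs.1.le θ)
  have hexp : Continuous (fun θ : ℝ => Complex.exp (θ * I)) := by fun_prop
  refine (intervalIntegral.hasDerivAt_integral_of_dominated_loc_of_deriv_le
    (F := fun s θ => g (circleMap c s θ) * chE m θ)
    (F' := fun s θ => fderiv ℝ g (circleMap c s θ) (Complex.exp (θ * I)) * chE m θ)
    (s := Ioo 0 r') (bound := fun _ => M) (Ioo_mem_nhds h0 hr1) ?_ ?_ ?_ ?_ ?_ ?_).2
  · filter_upwards [Ioo_mem_nhds h0 hr1] with s hs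
    exact ((circle_cont_comp hg.continuousOn hs.1.le (hs.2.trans hr2)).mul
      (chE_cont m)).aestronglyMeasurable
  · exact ((circle_cont_comp hg.continuousOn h0.le hr).mul (chE_cont m)).intervalIntegrable _ _
  · exact (((circle_cont_comp hcF h0.le hr).clm_apply hexp).mul (chE_cont m)).aestronglyMeasurable
  · refine ae_of_all _ (fun θ _ s hs => ?_)
    rw [norm_mul, chE_norm, mul_one]
    refine (ContinuousLinearMap.le_opNorm _ _).trans ?_
    rw [Complex.norm_exp_ofReal_mul_I, mul_one]
    exact hM _ (hmem s hs θ)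
  · exact intervalIntegrable_const
  · refine ae_of_all _ (fun θ _ s hs => ?_)
    refine HasDerivAt.mul_const ?_ _
    have h1 := (diffAt_of isOpen_ball hg
      (closedBall_subset_ball hr2 (hmem s hs θ))).hasFDerivAt
    have h2 : HasDerivAt (fun s : ℝ => circleMap c s θ) (Complex.exp (θ * I)) s := by
      simpa [circleMap] using
        (((Complex.ofRealCLM.hasDerivAt (x := s)).mul_const (Complex.exp (θ * I))).const_add c)
    exact h1.comp_hasDerivAt s h2

lemma coef_ibp {g : ℂ → ℂ} {c : ℂ} {r R : ℝ} (hg : ContDiffOn ℝ 1 g (ball c R))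
    (h0 : 0 < r) (hr : r < R) (m : ℤ) :
    (∫ θ in (0:ℝ)..(2 * Real.pi),
        fderiv ℝ g (circleMap c r θ) (I * Complex.exp (θ * I)) * chE m θ) =
    (m * I / r) * ∫ θ in (0:ℝ)..(2 * Real.pi), g (circleMap c r θ) * chE m θ := by
  have hcF := fd_cont isOpen_ball hg
  have hd : ∀ θ : ℝ, HasDerivAt (fun θ => g (circleMap c r θ))
      (fderiv ℝ g (circleMap c r θ) (circleMap 0 r θ * I)) θ := fun θ =>
    (diffAt_of isOpen_ball hg (circle_mem h0.le hr θ)).hasFDerivAt.comp_hasDerivAt θ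
      (hasDerivAt_circleMap c r θ)
  have hc : Continuous (fun θ => fderiv ℝ g (circleMap c r θ) (circleMap 0 r θ * I)) :=
    (circle_cont_comp hcF h0.le hr).clm_apply ((continuous_circleMap 0 r).mul continuous_const)
  have key := intervalIntegral.integral_mul_deriv_eq_deriv_mul
    (u := fun θ => g (circleMap c r θ)) (v := chE m)
    (a := 0) (b := 2 * Real.pi) (fun θ _ => hd θ) (fun θ _ => chE_hasDerivAt m θ)
    (hc.intervalIntegrable _ _)
    (((chE_cont m).mul continuous_const).intervalIntegrable _ _)
  have hper : circleMap c r (2 * Real.pi) = circleMap c r 0 := by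
    simpa using periodic_circleMap c r 0
  rw [chE_zero, chE_two_pi, hper, sub_self, zero_sub] at key
  have e1 : (∫ θ in (0:ℝ)..(2 * Real.pi),
      fderiv ℝ g (circleMap c r θ) (circleMap 0 r θ * I) * chE m θ)
      = r * ∫ θ in (0:ℝ)..(2 * Real.pi),
        fderiv ℝ g (circleMap c r θ) (I * Complex.exp (θ * I)) * chE m θ := by
    rw [← intervalIntegral.integral_const_mul]
    congr 1; ext θ
    have : circleMap 0 r θ * I = r • (I * Complex.exp (θ * I)) := by
      simp [circleMap]; ring
    rw [this, map_smul, Complex.real_smul]; ring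
  have e2 : (∫ θ in (0:ℝ)..(2 * Real.pi), g (circleMap c r θ) * (chE m θ * (-(m : ℂ) * I)))
      = (-(m : ℂ) * I) * ∫ θ in (0:ℝ)..(2 * Real.pi), g (circleMap c r θ) * chE m θ := by
    rw [← intervalIntegral.integral_const_mul]
    congr 1; ext θ; ring
  rw [e1, e2] at key
  have hr0 : (r : ℂ) ≠ 0 := by exact_mod_cast h0.ne'
  rw [div_mul_eq_mul_div, eq_div_iff hr0]
  linear_combination key

/-- First-order system equivalent to Helmholtz. -/
structure HSys (k : ℂ) (S : Set ℂ) (w f : ℂ → ℂ) : Prop where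
  cw : ContDiffOn ℝ 1 w S
  cf : ContDiffOn ℝ 1 f S
  h1 : ∀ z ∈ S, fderiv ℝ w z 1 - I * fderiv ℝ w z I = f z
  h2 : ∀ z ∈ S, fderiv ℝ f z 1 + I * fderiv ℝ f z I = k * w z

lemma HSys.mono {k : ℂ} {S T : Set ℂ} {w f : ℂ → ℂ} (h : HSys k S w f) (hT : T ⊆ S) :
    HSys k T w f :=
  ⟨h.cw.mono hT, h.cf.mono hT, fun z hz => h.h1 z (hT hz), fun z hz => h.h2 z (hT hz)⟩

lemma clm_exp (L : ℂ →L[ℝ] ℂ) (θ : ℝ) :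
    L (Complex.exp (θ * I)) = Real.cos θ * L 1 + Real.sin θ * L I := by
  have : Complex.exp (θ * I) = Real.cos θ • (1 : ℂ) + Real.sin θ • I := by
    rw [Complex.exp_mul_I]; simp
  rw [this, map_add, map_smul, map_smul, Complex.real_smul, Complex.real_smul]

lemma clm_Iexp (L : ℂ →L[ℝ] ℂ) (θ : ℝ) :
    L (I * Complex.exp (θ * I)) = -Real.sin θ * L 1 + Real.cos θ * L I := by
  have : I * Complex.exp (θ * I) = (-Real.sin θ) • (1 : ℂ) + Real.cos θ • I := by
    rw [Complex.exp_mul_I]; simp; linear_combination Complex.sin θ * Complex.I_sq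
  rw [this, map_add, map_smul, map_smul, Complex.real_smul, Complex.real_smul]
  push_cast; ring

lemma coef_ode {k : ℂ} {w f : ℂ → ℂ} {c : ℂ} {r R : ℝ} (h : HSys k (ball c R) w f)
    (h0 : 0 < r) (hr : r < R) (m : ℤ) :
    HasDerivAt (fun s : ℝ => ∫ θ in (0:ℝ)..(2 * Real.pi), w (circleMap c s θ) * chE m θ)
      ((∫ θ in (0:ℝ)..(2 * Real.pi), f (circleMap c r θ) * chE (m - 1) θ)
        - (m / r) * ∫ θ in (0:ℝ)..(2 * Real.pi), w (circleMap c r θ) * chE m θ) r ∧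
    HasDerivAt (fun s : ℝ => ∫ θ in (0:ℝ)..(2 * Real.pi), f (circleMap c s θ) * chE (m - 1) θ)
      (k * (∫ θ in (0:ℝ)..(2 * Real.pi), w (circleMap c r θ) * chE m θ)
        + ((m - 1) / r) *
          ∫ θ in (0:ℝ)..(2 * Real.pi), f (circleMap c r θ) * chE (m - 1) θ) r := by
  have cw := circle_cont_comp h.cw.continuousOn h0.le hr
  have cf := circle_cont_comp h.cf.continuousOn h0.le hr
  have hexp : Continuous (fun θ : ℝ => I * Complex.exp (θ * I)) := by fun_prop
  have cw' := (circle_cont_comp (fd_cont isOpen_ball h.cw) h0.le hr).clm_apply hexp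
  have cf' := (circle_cont_comp (fd_cont isOpen_ball h.cf) h0.le hr).clm_apply hexp
  constructor
  · convert coef_hasDerivAt h.cw h0 hr m using 1
    have e : ∀ θ : ℝ, fderiv ℝ w (circleMap c r θ) (Complex.exp (θ * I)) * chE m θ
        = f (circleMap c r θ) * chE (m - 1) θ
          + I * (fderiv ℝ w (circleMap c r θ) (I * Complex.exp (θ * I)) * chE m θ) := by
      intro θ
      rw [← h.h1 _ (circle_mem h0.le hr θ), ← chE_shift, clm_exp, clm_Iexp, Complex.exp_mul_I]
      push_cast
      ring_nf
      simp only [Complex.I_sq]; ring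
    simp_rw [e]
    have i1 : IntervalIntegrable (fun θ => f (circleMap c r θ) * chE (m - 1) θ) volume
        0 (2 * Real.pi) := (cf.mul (chE_cont _)).intervalIntegrable _ _
    have i2 : IntervalIntegrable (fun θ : ℝ => I *
        (fderiv ℝ w (circleMap c r θ) (I * Complex.exp (θ * I)) * chE m θ)) volume
        0 (2 * Real.pi) :=
      (continuous_const.mul (cw'.mul (chE_cont _))).intervalIntegrable _ _
    rw [intervalIntegral.integral_add i1 i2,
      intervalIntegral.integral_const_mul, coef_ibp h.cw h0 hr]
    linear_combination (-(m / r) * ∫ θ in (0:ℝ)..(2 * Real.pi), w (circleMap c r θ) * chE m θ)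
      * Complex.I_sq
  · convert coef_hasDerivAt h.cf h0 hr (m - 1) using 1
    have e : ∀ θ : ℝ, fderiv ℝ f (circleMap c r θ) (Complex.exp (θ * I)) * chE (m - 1) θ
        = k * (w (circleMap c r θ) * chE m θ)
          - I * (fderiv ℝ f (circleMap c r θ) (I * Complex.exp (θ * I)) * chE (m - 1) θ) := by
      intro θ
      rw [← mul_assoc, ← h.h2 _ (circle_mem h0.le hr θ), ← chE_shift' m θ, clm_exp, clm_Iexp,
        ← neg_mul, Complex.exp_mul_I, Complex.cos_neg, Complex.sin_neg]
      push_cast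
      ring_nf
      simp only [Complex.I_sq]; ring
    simp_rw [e]
    have i1 : IntervalIntegrable (fun θ => k * (w (circleMap c r θ) * chE m θ)) volume
        0 (2 * Real.pi) := (continuous_const.mul (cw.mul (chE_cont _))).intervalIntegrable _ _
    have i2 : IntervalIntegrable (fun θ : ℝ => I *
        (fderiv ℝ f (circleMap c r θ) (I * Complex.exp (θ * I)) * chE (m - 1) θ)) volume
        0 (2 * Real.pi) :=
      (continuous_const.mul (cf'.mul (chE_cont _))).intervalIntegrable _ _
    rw [intervalIntegral.integral_sub i1 i2,
      intervalIntegral.integral_const_mul, intervalIntegral.integral_const_mul,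
      coef_ibp h.cf h0 hr]
    push_cast
    linear_combination (((m - 1) / r) *
      ∫ θ in (0:ℝ)..(2 * Real.pi), f (circleMap c r θ) * chE (m - 1) θ) * Complex.I_sq

lemma coef_zero {k : ℂ} {w f : ℂ → ℂ} {c : ℂ} {ρ r R : ℝ} (h : HSys k (ball c R) w f)
    (hρ : 0 < ρ) (hw0 : ∀ z ∈ ball c ρ, w z = 0) (hf0 : ∀ z ∈ ball c ρ, f z = 0)
    (hr : r < R) (hρr : ρ / 2 ≤ r) (m : ℤ) :
    ∫ θ in (0:ℝ)..(2 * Real.pi), w (circleMap c r θ) * chE m θ = 0 := by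
  set A : ℝ → ℂ := fun s => ∫ θ in (0:ℝ)..(2 * Real.pi), w (circleMap c s θ) * chE m θ with hA
  set B : ℝ → ℂ := fun s => ∫ θ in (0:ℝ)..(2 * Real.pi), f (circleMap c s θ) * chE (m - 1) θ
    with hB
  have hd : ∀ s ∈ Icc (ρ / 2) r, HasDerivAt (fun s => (A s, B s))
      (B s - (m / s) * A s, k * A s + ((m - 1) / s) * B s) s := by
    intro s hs
    have := coef_ode h (by linarith [hs.1] : 0 < s) (by linarith [hs.2] : s < R) m
    exact this.1.prodMk this.2
  have hmem : ∀ θ, circleMap c (ρ / 2) θ ∈ ball c ρ := fun θ =>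
    circle_mem (by linarith) (by linarith) θ
  have key := eq_zero_of_abs_deriv_le_mul_abs_self_of_eq_zero_right
    (f := fun s => (A s, B s)) (f' := fun s => (B s - (m / s) * A s, k * A s + ((m - 1) / s) * B s))
    (K := 1 + ‖k‖ + (‖(m : ℂ)‖ + ‖(m : ℂ) - 1‖) / (ρ / 2)) (a := ρ / 2) (b := r)
    (fun s hs => (hd s hs).continuousAt.continuousWithinAt)
    (fun s hs => (hd s (Ico_subset_Icc_self hs)).hasDerivWithinAt)
    (by simp [hA, hB, hw0 _ (hmem _), hf0 _ (hmem _)]) ?_ r ⟨hρr, le_rfl⟩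
  · exact congrArg Prod.fst key
  · intro s hs
    have hs0 : 0 < s := by linarith [hs.1]
    have hA' : ‖A s‖ ≤ ‖(A s, B s)‖ := norm_fst_le (A s, B s)
    have hB' : ‖B s‖ ≤ ‖(A s, B s)‖ := norm_snd_le (A s, B s)
    set N := ‖(A s, B s)‖
    have hN : 0 ≤ N := norm_nonneg _
    have hq : ∀ x : ℂ, ‖x / (s : ℂ)‖ ≤ ‖x‖ / (ρ / 2) := by
      intro x
      rw [norm_div, Complex.norm_real, Real.norm_of_nonneg hs0.le]
      exact div_le_div_of_nonneg_left (norm_nonneg _) (by linarith) hs.1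
    have p1 : 0 ≤ ‖(m : ℂ)‖ / (ρ / 2) := by positivity
    have p2 : 0 ≤ ‖(m : ℂ) - 1‖ / (ρ / 2) := by positivity
    have p3 := norm_nonneg k
    rw [add_div]
    refine norm_prod_le_iff.2 ⟨?_, ?_⟩
    · have : ‖B s - (m / s) * A s‖ ≤ N + ‖(m : ℂ)‖ / (ρ / 2) * N := by
        refine (norm_sub_le _ _).trans (add_le_add hB' ?_)
        rw [norm_mul]
        exact mul_le_mul (hq _) hA' (norm_nonneg _) p1
      refine this.trans ?_
      nlinarith [mul_nonneg p2 hN, mul_nonneg p3 hN]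
    · have : ‖k * A s + ((m - 1) / s) * B s‖ ≤ ‖k‖ * N + ‖(m : ℂ) - 1‖ / (ρ / 2) * N := by
        refine (norm_add_le _ _).trans (add_le_add ?_ ?_)
        · rw [norm_mul]; exact mul_le_mul_of_nonneg_left hA' p3
        · rw [norm_mul]
          exact mul_le_mul (hq _) hB' (norm_nonneg _) p2
      refine this.trans ?_
      nlinarith [mul_nonneg p1 hN, mul_nonneg p3 hN]

lemma fourier_unique {g : ℝ → ℂ} (hg : Continuous g) (hp : Function.Periodic g (2 * Real.pi))
    (h : ∀ m : ℤ, ∫ θ in (0:ℝ)..(2 * Real.pi), g θ * chE m θ = 0) (θ : ℝ) : g θ = 0 := by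
  have : Fact (0 < 2 * Real.pi) := ⟨by positivity⟩
  let G : C(AddCircle (2 * Real.pi), ℂ) := ⟨hp.lift, hg.quotient_lift _⟩
  have hG : ∀ x : ℝ, G (x : AddCircle (2 * Real.pi)) = g x := fun x => hp.lift_coe x
  have hc : fourierCoeff G = 0 := by
    ext m
    rw [fourierCoeff_eq_intervalIntegral _ m 0, zero_add]
    have : (∫ x in (0:ℝ)..(2 * Real.pi), (fourier (-m) (x : AddCircle (2 * Real.pi))) •
        G (x : AddCircle (2 * Real.pi))) = 0 := by
      rw [← h m]
      congr 1; ext x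
      rw [hG, fourier_coe_apply, chE, smul_eq_mul, mul_comm]
      congr 2
      have : (Real.pi : ℂ) ≠ 0 := by exact_mod_cast Real.pi_ne_zero
      push_cast
      field_simp
    rw [this]; simp
  have := has_pointwise_sum_fourier_series_of_summable (f := G) (by rw [hc]; exact summable_zero)
    (θ : AddCircle (2 * Real.pi))
  rw [hc, hG] at this
  simp only [Pi.zero_apply, zero_smul] at this
  exact this.unique hasSum_zero

lemma ball_zero {k : ℂ} {w f : ℂ → ℂ} {c : ℂ} {ρ R : ℝ} (h : HSys k (ball c R) w f)
    (hρ : 0 < ρ) (hw0 : ∀ z ∈ ball c ρ, w z = 0) (hf0 : ∀ z ∈ ball c ρ, f z = 0) :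
    ∀ z ∈ ball c R, w z = 0 := by
  intro z hz
  by_cases hzρ : z ∈ ball c ρ
  · exact hw0 z hzρ
  have hz1 : ρ ≤ ‖z - c‖ := by simpa [dist_eq_norm] using hzρ
  have hz2 : ‖z - c‖ < R := by simpa [dist_eq_norm] using hz
  have hcont := circle_cont_comp h.cw.continuousOn (norm_nonneg (z - c)) hz2
  have := fourier_unique hcont ((periodic_circleMap c ‖z - c‖).comp w)
    (fun m => coef_zero h hρ hw0 hf0 hz2 (by linarith) m) (Complex.arg (z - c))
  rw [circleMap, Complex.norm_mul_exp_arg_mul_I] at this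
  simpa using this

lemma uc {k : ℂ} {S : Set ℂ} {w f : ℂ → ℂ} (hS : IsOpen S) (hc : IsPreconnected S)
    (h : HSys k S w f) {p : ℂ} (hp : p ∈ S) (hwp : ∀ᶠ z in 𝓝 p, w z = 0) :
    ∀ z ∈ S, w z = 0 := by
  suffices hsub : S ⊆ {p | ∀ᶠ z in 𝓝 p, w z = 0} from fun z hz => (hsub hz).self_of_nhds
  refine hc.subset_of_closure_inter_subset isOpen_setOf_eventually_nhds ⟨p, hp, hwp⟩ ?_
  rintro x ⟨hx, hxS⟩
  obtain ⟨ε, hε, hεS⟩ := Metric.isOpen_iff.1 hS x hxS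
  obtain ⟨q, hq, hxq⟩ := Metric.mem_closure_iff.1 hx (ε / 2) (by positivity)
  have hsub : ball q (ε / 2) ⊆ S := by
    refine Subset.trans (ball_subset_ball' ?_) hεS
    rw [dist_comm]; linarith
  have hqS : q ∈ S := hsub (mem_ball_self (by positivity))
  have hq1 : ∀ᶠ z in 𝓝 q, w z = 0 ∧ f z = 0 := by
    filter_upwards [hq, eventually_eventually_nhds.2 hq, hS.mem_nhds hqS] with z h1 h2 h3
    refine ⟨h1, ?_⟩
    have h4 : w =ᶠ[𝓝 z] fun _ => 0 := h2
    rw [← h.h1 z h3, h4.fderiv_eq]; simp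
  obtain ⟨ρ, hρ, hρ0⟩ := Metric.eventually_nhds_iff_ball.1 hq1
  have := ball_zero (h.mono hsub) hρ (fun z hz => (hρ0 z hz).1) (fun z hz => (hρ0 z hz).2)
  exact Metric.eventually_nhds_iff_ball.2 ⟨ε / 2 - dist x q, by linarith, fun z hz => this z (by
    have h1 := dist_triangle z x q
    have h2 := mem_ball.1 hz
    exact mem_ball.2 (by linarith))⟩

/-- Extension by zero from the upper half plane. -/
noncomputable def up {E : Type*} [Zero E] (g : ℂ → E) : ℂ → E := indicator {z | 0 < z.im} g

lemma up_norm {E : Type*} [NormedAddCommGroup E] (g : ℂ → E) (z : ℂ) : ‖up g z‖ ≤ ‖g z‖ :=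
  norm_indicator_le_norm_self _ _

lemma up_eq {E : Type*} [Zero E] (g : ℂ → E) {z : ℂ} (hz : 0 < z.im) : up g z = g z :=
  indicator_of_mem (s := {z : ℂ | 0 < z.im}) hz g

lemma up_zero {E : Type*} [Zero E] (g : ℂ → E) {z : ℂ} (hz : z.im ≤ 0) : up g z = 0 :=
  indicator_of_notMem (s := {z : ℂ | 0 < z.im}) (not_lt.2 hz) g

lemma up_ev_pos {E : Type*} [Zero E] (g : ℂ → E) {z : ℂ} (hz : 0 < z.im) : up g =ᶠ[𝓝 z] g := by
  filter_upwards [(isOpen_lt continuous_const Complex.continuous_im).mem_nhds hz] with y hy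
  exact up_eq g hy

lemma up_ev_neg {E : Type*} [Zero E] (g : ℂ → E) {z : ℂ} (hz : z.im < 0) :
    up g =ᶠ[𝓝 z] fun _ => 0 := by
  filter_upwards [(isOpen_lt Complex.continuous_im continuous_const).mem_nhds hz] with y hy
  exact up_zero g (le_of_lt hy)

lemma up_cont {E : Type*} [NormedAddCommGroup E] {g : ℂ → E} {S : Set ℂ} (hS : IsOpen S)
    (hg : ContinuousOn g S) (h0 : ∀ z ∈ S, z.im = 0 → g z = 0) : ContinuousOn (up g) S := by
  intro z hz
  refine ContinuousAt.continuousWithinAt ?_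
  have hgz := hg.continuousAt (hS.mem_nhds hz)
  rcases lt_trichotomy z.im 0 with h | h | h
  · exact continuousAt_const.congr (up_ev_neg g h).symm
  · rw [ContinuousAt, up_zero g h.le]
    rw [ContinuousAt, h0 z hz h] at hgz
    exact squeeze_zero_norm (up_norm g) (by simpa using hgz.norm)
  · exact hgz.congr (up_ev_pos g h).symm

lemma up_fderiv {g : ℂ → ℂ} {S : Set ℂ} (hS : IsOpen S) (hg : ContDiffOn ℝ 1 g S)
    (h0 : ∀ z ∈ S, z.im = 0 → g z = 0) (h1 : ∀ z ∈ S, z.im = 0 → fderiv ℝ g z = 0) :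
    ∀ z ∈ S, HasFDerivAt (up g) (up (fderiv ℝ g) z) z := by
  intro z hz
  have hd := (diffAt_of hS hg hz).hasFDerivAt
  rcases lt_trichotomy z.im 0 with h | h | h
  · rw [up_zero _ h.le]
    exact (hasFDerivAt_const (0 : ℂ) z).congr_of_eventuallyEq (up_ev_neg g h)
  · rw [up_zero _ h.le]
    rw [h1 z hz h] at hd
    rw [hasFDerivAt_iff_isLittleO] at hd ⊢
    refine Asymptotics.IsBigO.trans_isLittleO (Asymptotics.IsBigO.of_bound 1 ?_) hd
    refine Eventually.of_forall (fun y => ?_)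
    simpa [h0 z hz h, up_zero g h.le] using up_norm g y
  · rw [up_eq _ h]
    exact hd.congr_of_eventuallyEq (up_ev_pos g h)

lemma up_contDiff {g : ℂ → ℂ} {S : Set ℂ} (hS : IsOpen S) (hg : ContDiffOn ℝ 1 g S)
    (h0 : ∀ z ∈ S, z.im = 0 → g z = 0) (h1 : ∀ z ∈ S, z.im = 0 → fderiv ℝ g z = 0) :
    ContDiffOn ℝ 1 (up g) S := by
  have hd := up_fderiv hS hg h0 h1
  rw [show (1 : WithTop ℕ∞) = 0 + 1 by simp, contDiffOn_succ_iff_fderiv_of_isOpen hS]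
  refine ⟨fun z hz => (hd z hz).differentiableAt.differentiableWithinAt, by simp, ?_⟩
  rw [contDiffOn_zero]
  exact (up_cont hS (fd_cont hS hg) h1).congr (fun z hz => (hd z hz).fderiv)

lemma up_sys {k : ℂ} {S : Set ℂ} {w f : ℂ → ℂ} (hS : IsOpen S) (h : HSys k S w f)
    (w0 : ∀ z ∈ S, z.im = 0 → w z = 0) (w1 : ∀ z ∈ S, z.im = 0 → fderiv ℝ w z = 0)
    (f0 : ∀ z ∈ S, z.im = 0 → f z = 0) (f1 : ∀ z ∈ S, z.im = 0 → fderiv ℝ f z = 0) :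
    HSys k S (up w) (up f) := by
  refine ⟨up_contDiff hS h.cw w0 w1, up_contDiff hS h.cf f0 f1, fun z hz => ?_, fun z hz => ?_⟩
  · rw [(up_fderiv hS h.cw w0 w1 z hz).fderiv]
    rcases le_or_gt z.im 0 with h' | h'
    · simp [up_zero _ h']
    · rw [up_eq _ h', up_eq _ h', h.h1 z hz]
  · rw [(up_fderiv hS h.cf f0 f1 z hz).fderiv]
    rcases le_or_gt z.im 0 with h' | h'
    · simp [up_zero _ h']
    · rw [up_eq _ h', up_eq _ h', h.h2 z hz]

lemma clm_ext {L : ℂ →L[ℝ] ℂ} (h1 : L 1 = 0) (hI : L I = 0) : L = 0 := by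
  ext z
  have : z = z.re • (1 : ℂ) + z.im • I := by simp
  rw [this, map_add, map_smul, map_smul, h1, hI]; simp

lemma fderiv_one_real {g : ℂ → ℂ} {S : Set ℂ} (hS : IsOpen S) (hg : ContDiffOn ℝ 1 g S)
    (h0 : ∀ z ∈ S, z.im = 0 → g z = 0) {z : ℂ} (hz : z ∈ S) (hzi : z.im = 0) :
    fderiv ℝ g z 1 = 0 := by
  have hl : HasDerivAt (fun t : ℝ => z + (t : ℂ)) 1 0 := by
    simpa using (Complex.ofRealCLM.hasDerivAt (x := 0)).const_add z
  have hd : HasFDerivAt g (fderiv ℝ g z) (z + ((0 : ℝ) : ℂ)) := by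
    simpa using (diffAt_of hS hg hz).hasFDerivAt
  have h1 := hd.comp_hasDerivAt (0 : ℝ) hl
  have hev : ∀ᶠ t : ℝ in 𝓝 0, z + (t : ℂ) ∈ S :=
    hl.continuousAt.eventually_mem (hS.mem_nhds (by simpa using hz))
  have h2 : (g ∘ fun t : ℝ => z + (t : ℂ)) =ᶠ[𝓝 0] fun _ => 0 := by
    filter_upwards [hev] with t ht
    exact h0 _ ht (by simp [hzi])
  rw [← h1.deriv, h2.deriv_eq]; simp

lemma cauchy_zero {k : ℂ} {S : Set ℂ} {w f : ℂ → ℂ} (hS : IsOpen S) (hc : IsPreconnected S)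
    (h : HSys k S w f) {x : ℂ} (hx : x ∈ S) (hxi : x.im = 0)
    (w0 : ∀ z ∈ S, z.im = 0 → w z = 0) (wI : ∀ z ∈ S, z.im = 0 → fderiv ℝ w z I = 0) :
    ∀ z ∈ S, w z = 0 := by
  have w1 : ∀ z ∈ S, z.im = 0 → fderiv ℝ w z = 0 := fun z hz hi =>
    clm_ext (fderiv_one_real hS h.cw w0 hz hi) (wI z hz hi)
  have f0 : ∀ z ∈ S, z.im = 0 → f z = 0 := fun z hz hi => by
    rw [← h.h1 z hz, w1 z hz hi]; simp
  have f1 : ∀ z ∈ S, z.im = 0 → fderiv ℝ f z = 0 := fun z hz hi => by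
    have a := fderiv_one_real hS h.cf f0 hz hi
    refine clm_ext a ?_
    have := h.h2 z hz
    rw [a, w0 z hz hi] at this
    simpa using this
  have hup := up_sys hS h w0 w1 f0 f1
  obtain ⟨ε, hε, hεS⟩ := Metric.isOpen_iff.1 hS x hx
  have hm : ∀ s : ℝ, |s| < ε → x + s * I ∈ ball x ε := by
    intro s hs
    simpa [dist_eq_norm] using hs
  have hlow := uc isOpen_ball (convex_ball x ε).isPreconnected (hup.mono hεS)
    (hm (-(ε / 2)) (by rw [abs_neg, abs_of_pos] <;> linarith))
    (up_ev_neg w (by simp [hxi]; exact hε))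
  have hq : x + ((ε / 2 : ℝ) : ℂ) * I ∈ ball x ε := hm (ε / 2) (by rw [abs_of_pos] <;> linarith)
  refine uc hS hc h (hεS hq) ?_
  have him : 0 < (x + ((ε / 2 : ℝ) : ℂ) * I).im := by simp [hxi]; exact hε
  filter_upwards [up_ev_pos w him, isOpen_ball.mem_nhds hq] with z hz1 hz2
  rw [← hz1, hlow z hz2]

lemma dx_eq {u : ℂ → ℝ} {z : ℂ} (h : DifferentiableAt ℝ u z) : dx u z = fderiv ℝ u z 1 := by
  have hl : HasDerivAt (fun t : ℝ => z + (t : ℂ)) 1 0 := by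
    simpa using (Complex.ofRealCLM.hasDerivAt (x := 0)).const_add z
  have hd : HasFDerivAt u (fderiv ℝ u z) (z + ((0 : ℝ) : ℂ)) := by simpa using h.hasFDerivAt
  exact (hd.comp_hasDerivAt (0 : ℝ) hl).deriv

lemma dy_eq {u : ℂ → ℝ} {z : ℂ} (h : DifferentiableAt ℝ u z) : dy u z = fderiv ℝ u z I := by
  have hl : HasDerivAt (fun t : ℝ => z + (t : ℂ) * I) I 0 := by
    simpa using ((Complex.ofRealCLM.hasDerivAt (x := 0)).mul_const I).const_add z
  have hd : HasFDerivAt u (fderiv ℝ u z) (z + ((0 : ℝ) : ℂ) * I) := by simpa using h.hasFDerivAt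
  exact (hd.comp_hasDerivAt (0 : ℝ) hl).deriv

lemma fderiv_ofReal {u : ℂ → ℝ} {z : ℂ} (h : DifferentiableAt ℝ u z) (v : ℂ) :
    fderiv ℝ (fun z => (u z : ℂ)) z v = (fderiv ℝ u z v : ℂ) := by
  have := (Complex.ofRealCLM.hasFDerivAt (x := u z)).comp z h.hasFDerivAt
  have e : HasFDerivAt (fun z => (u z : ℂ)) (Complex.ofRealCLM.comp (fderiv ℝ u z)) z := this
  rw [e.fderiv]; rfl

lemma sys_of_helm {lam : ℝ} {S : Set ℂ} (hS : IsOpen S) {u : ℂ → ℝ} (hu : ContDiffOn ℝ 2 u S)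
    (hh : ∀ z ∈ S, lap u z + lam ^ 2 * u z = 0) :
    HSys (-(lam : ℂ) ^ 2) S (fun z => (u z : ℂ))
      (fun z => (fderiv ℝ u z 1 : ℂ) - I * (fderiv ℝ u z I : ℂ)) := by
  have hud : ∀ z ∈ S, DifferentiableAt ℝ u z := fun z hz =>
    (hu.differentiableOn two_ne_zero).differentiableAt (hS.mem_nhds hz)
  have hF : ContDiffOn ℝ 1 (fderiv ℝ u) S :=
    hu.fderiv_of_isOpen hS (by norm_num)
  have hv : ∀ v : ℂ, ContDiffOn ℝ 1 (fun z => fderiv ℝ u z v) S := fun v =>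
    hF.clm_apply contDiffOn_const
  have hFd : ∀ z ∈ S, DifferentiableAt ℝ (fderiv ℝ u) z := fun z hz =>
    (hF.differentiableOn one_ne_zero).differentiableAt (hS.mem_nhds hz)
  have hvd : ∀ v : ℂ, ∀ z ∈ S, DifferentiableAt ℝ (fun z => fderiv ℝ u z v) z := fun v z hz =>
    ((hv v).differentiableOn one_ne_zero).differentiableAt (hS.mem_nhds hz)
  have hvf : ∀ v w : ℂ, ∀ z ∈ S,
      fderiv ℝ (fun z => fderiv ℝ u z v) z w = fderiv ℝ (fderiv ℝ u) z w v := by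
    intro v w z hz
    rw [fderiv_clm_apply (hFd z hz) (differentiableAt_const v)]
    simp
  have hor : ∀ v : ℂ, ContDiffOn ℝ 1 (fun z => (fderiv ℝ u z v : ℂ)) S := fun v =>
    Complex.ofRealCLM.contDiff.comp_contDiffOn (hv v)
  refine ⟨Complex.ofRealCLM.contDiff.comp_contDiffOn (hu.of_le (by norm_num)),
    (hor 1).sub (contDiffOn_const.mul (hor I)), fun z hz => ?_, fun z hz => ?_⟩
  · rw [fderiv_ofReal (hud z hz), fderiv_ofReal (hud z hz)]
  · have hsymm : IsSymmSndFDerivAt ℝ u z :=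
      (hu.contDiffAt (hS.mem_nhds hz)).isSymmSndFDerivAt (by simp)
    have hlap : lap u z = fderiv ℝ (fderiv ℝ u) z 1 1 + fderiv ℝ (fderiv ℝ u) z I I := by
      have e1 : dx u =ᶠ[𝓝 z] fun z => fderiv ℝ u z 1 := by
        filter_upwards [hS.mem_nhds hz] with y hy using dx_eq (hud y hy)
      have e2 : dy u =ᶠ[𝓝 z] fun z => fderiv ℝ u z I := by
        filter_upwards [hS.mem_nhds hz] with y hy using dy_eq (hud y hy)
      rw [lap, dx_eq ((hvd 1 z hz).congr_of_eventuallyEq e1),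
        dy_eq ((hvd I z hz).congr_of_eventuallyEq e2), e1.fderiv_eq, e2.fderiv_eq,
        hvf _ _ z hz, hvf _ _ z hz]
    have hd : ∀ v, DifferentiableAt ℝ (fun z => (fderiv ℝ u z v : ℂ)) z := fun v =>
      diffAt_of hS (hor v) hz
    have e : ∀ v, fderiv ℝ (fun z => (fderiv ℝ u z 1 : ℂ) - I * (fderiv ℝ u z I : ℂ)) z v
        = (fderiv ℝ (fderiv ℝ u) z v 1 : ℂ) - I * (fderiv ℝ (fderiv ℝ u) z v I : ℂ) := by
      intro v
      rw [fderiv_fun_sub (hd 1) ((hd I).const_mul I), fderiv_const_mul (hd I)]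
      simp only [ContinuousLinearMap.sub_apply, ContinuousLinearMap.smul_apply, smul_eq_mul]
      rw [fderiv_ofReal (hvd 1 z hz), fderiv_ofReal (hvd I z hz), hvf _ _ z hz, hvf _ _ z hz]
    rw [e, e, hsymm.eq I 1]
    have h3 := hh z hz
    rw [hlap] at h3
    have h4 : ((fderiv ℝ (fderiv ℝ u) z 1 1 : ℝ) : ℂ) + (fderiv ℝ (fderiv ℝ u) z I I : ℝ)
      + (lam : ℂ) ^ 2 * (u z : ℂ) = 0 := by exact_mod_cast h3
    linear_combination h4 - ((fderiv ℝ (fderiv ℝ u) z I I : ℝ) : ℂ) * Complex.I_sq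

lemma HSys.add {k : ℂ} {S : Set ℂ} (hS : IsOpen S) {w f w' f' : ℂ → ℂ} (h : HSys k S w f)
    (h' : HSys k S w' f') : HSys k S (fun z => w z + w' z) (fun z => f z + f' z) := by
  refine ⟨h.cw.add h'.cw, h.cf.add h'.cf, fun z hz => ?_, fun z hz => ?_⟩
  · rw [fderiv_fun_add (diffAt_of hS h.cw hz) (diffAt_of hS h'.cw hz), ← h.h1 z hz, ← h'.h1 z hz]
    simp only [ContinuousLinearMap.add_apply]; ring
  · rw [fderiv_fun_add (diffAt_of hS h.cf hz) (diffAt_of hS h'.cf hz), mul_add,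
      ← h.h2 z hz, ← h'.h2 z hz]
    simp only [ContinuousLinearMap.add_apply]; ring

lemma dx_conj (u : ℂ → ℝ) :
    dx (fun z => u ((starRingEnd ℂ) z)) = fun z => dx u ((starRingEnd ℂ) z) := by
  ext z; simp [dx]

lemma dy_conj (u : ℂ → ℝ) :
    dy (fun z => u ((starRingEnd ℂ) z)) = fun z => -dy u ((starRingEnd ℂ) z) := by
  ext z
  have := deriv_comp_neg (fun t : ℝ => u ((starRingEnd ℂ) z + t * I)) 0
  simp only [neg_zero] at this
  rw [dy, dy, ← this]
  simp

lemma dy_neg (u : ℂ → ℝ) (z : ℂ) : dy (fun z => -u z) z = -dy u z := by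
  simp [dy]

lemma lap_conj (u : ℂ → ℝ) (z : ℂ) :
    lap (fun z => u ((starRingEnd ℂ) z)) z = lap u ((starRingEnd ℂ) z) := by
  rw [lap, lap, dx_conj, dx_conj, dy_conj, dy_neg, dy_conj (dy u), neg_neg]

/-- Antisymmetric reflection principle for the Helmholtz equation
`Δu + λ²u = 0` across the real axis with homogeneous Dirichlet data. -/
theorem helmholtz_dirichlet_reflection
    (lam : ℝ) (Ω : Set ℂ) (hΩ : IsOpen Ω) (hconn : IsConnected Ω)
    (hsym : ∀ z ∈ Ω, (starRingEnd ℂ) z ∈ Ω)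
    (hreal : ∃ x : ℝ, (x : ℂ) ∈ Ω)
    (u : ℂ → ℝ) (hu : ContDiffOn ℝ 2 u Ω)
    (hhelm : ∀ z ∈ Ω, lap u z + lam ^ 2 * u z = 0)
    (hbd : ∀ x : ℝ, (x : ℂ) ∈ Ω → u (x : ℂ) = 0) :
    ∀ z ∈ Ω, u ((starRingEnd ℂ) z) = -u z := by
  obtain ⟨x, hx⟩ := hreal
  have hu' : ContDiffOn ℝ 2 (fun z => u ((starRingEnd ℂ) z)) Ω :=
    hu.comp Complex.conjCLE.contDiff.contDiffOn hsym
  have hh' : ∀ z ∈ Ω, lap (fun z => u ((starRingEnd ℂ) z)) z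
      + lam ^ 2 * u ((starRingEnd ℂ) z) = 0 := fun z hz => by
    rw [lap_conj]; exact hhelm _ (hsym z hz)
  have hsys := (sys_of_helm hΩ hu hhelm).add hΩ (sys_of_helm hΩ hu' hh')
  have key := cauchy_zero hΩ hconn.isPreconnected hsys hx (by simp) ?_ ?_
  · intro z hz
    have h1 := key z hz
    have h2 : u z + u ((starRingEnd ℂ) z) = 0 := by exact_mod_cast h1
    linarith
  · intro z hz hi
    have hzr : z = (z.re : ℂ) := by apply Complex.ext <;> simp [hi]
    have h0 : u z = 0 := by rw [hzr]; exact hbd _ (hzr ▸ hz)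
    have hc : (starRingEnd ℂ) z = z := Complex.conj_eq_iff_im.2 hi
    simp [hc, h0]
  · intro z hz hi
    have hc : (starRingEnd ℂ) z = z := Complex.conj_eq_iff_im.2 hi
    have d1 : DifferentiableAt ℝ u z :=
      (hu.differentiableOn two_ne_zero).differentiableAt (hΩ.mem_nhds hz)
    have d2 : DifferentiableAt ℝ (fun z => u ((starRingEnd ℂ) z)) z :=
      (hu'.differentiableOn two_ne_zero).differentiableAt (hΩ.mem_nhds hz)
    rw [fderiv_fun_add (diffAt_of hΩ (sys_of_helm hΩ hu hhelm).cw hz)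
      (diffAt_of hΩ (sys_of_helm hΩ hu' hh').cw hz), ContinuousLinearMap.add_apply,
      fderiv_ofReal d1, fderiv_ofReal d2, ← dy_eq d1, ← dy_eq d2, dy_conj]
    simp [hc]
end

section
/- Let λ ∈ ℝ and let Ω ⊆ ℂ be open, connected, symmetric under complex conjugation, with Ω ∩ ℝ ≠ ∅. Let u : ℂ → ℝ be twice continuously differentiable on Ω with Δu + λ²·u = 0 on Ω, and suppose that for every real x ∈ Ω the derivative at t = 0 of the map t ↦ u(x + i·t) equals 0 (homogeneous Neumann condition on the real axis). Then u(conj z) = u(z) for every z ∈ Ω. -/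
open Complex

theorem hr_diff_int (L : ℝ) (A B : ℝ → ℝ → ℂ)
    (hA : ContinuousOn (fun q : ℝ × ℝ => A q.1 q.2) (Set.Iio L ×ˢ Set.univ))
    (hB : ContinuousOn (fun q : ℝ × ℝ => B q.1 q.2) (Set.Iio L ×ˢ Set.univ))
    (hd : ∀ s < L, ∀ θ, HasDerivAt (fun s => A s θ) (B s θ) s)
    (s : ℝ) (hs : s < L) (a b : ℝ) :
    HasDerivAt (fun s => ∫ θ in a..b, A s θ) (∫ θ in a..b, B s θ) s := by
  have cA : ∀ s < L, Continuous (A s) := fun s hs => by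
    rw [← continuousOn_univ]
    exact hA.comp (f := fun θ : ℝ => (s, θ)) (by fun_prop) (fun θ _ => ⟨hs, trivial⟩)
  have cB : ∀ s < L, Continuous (B s) := fun s hs => by
    rw [← continuousOn_univ]
    exact hB.comp (f := fun θ : ℝ => (s, θ)) (by fun_prop) (fun θ _ => ⟨hs, trivial⟩)
  obtain ⟨s', h1, h2⟩ := exists_between hs
  obtain ⟨C, hC⟩ := (isCompact_Icc (a := s - 1) (b := s')).prod (isCompact_uIcc (a := a) (b := b))
    |>.exists_bound_of_continuousOn
      (hB.mono (Set.prod_mono (fun x hx => lt_of_le_of_lt hx.2 h2) (Set.subset_univ _)))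
  refine (intervalIntegral.hasDerivAt_integral_of_dominated_loc_of_deriv_le
    (F := A) (F' := B) (bound := fun _ => C)
    (Icc_mem_nhds (by linarith : s - 1 < s) h1) ?_ ((cA s hs).intervalIntegrable _ _)
    (cB s hs).aestronglyMeasurable ?_ (by simp) ?_).2
  · filter_upwards [Iio_mem_nhds hs] with x hx using (cA x hx).aestronglyMeasurable
  · refine Filter.Eventually.of_forall fun t ht x hx => ?_
    exact hC (x, t) ⟨hx, Set.uIoc_subset_uIcc ht⟩
  · exact Filter.Eventually.of_forall fun t ht x hx => hd x (lt_of_le_of_lt hx.2 h2) t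

theorem hr_fourier (g : ℝ → ℂ) (hg : Continuous g) (hp : Function.Periodic g (2 * Real.pi))
    (h0 : ∀ n : ℤ, ∫ θ in (0:ℝ)..(2 * Real.pi), g θ * exp (-(n * I * θ)) = 0) : ∀ θ, g θ = 0 := by
  have : Fact (0 < 2 * Real.pi) := ⟨Real.two_pi_pos⟩
  let f : C(AddCircle (2 * Real.pi), ℂ) := ⟨hp.lift, by
    exact continuous_quot_lift _ hg⟩
  have hc : fourierCoeff f = 0 := by
    ext n
    rw [fourierCoeff_eq_intervalIntegral _ _ 0, Pi.zero_apply]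
    have := h0 n
    rw [zero_add]
    refine smul_eq_zero_of_right _ ?_
    rw [← this]
    refine intervalIntegral.integral_congr fun x _ => ?_
    simp only [fourier_coe_apply, smul_eq_mul]
    rw [mul_comm]
    congr 2
    push_cast
    have : (Real.pi : ℂ) ≠ 0 := by exact_mod_cast Real.pi_ne_zero
    field_simp
  intro θ
  have := has_pointwise_sum_fourier_series_of_summable (f := f) (by rw [hc]; exact summable_zero) (θ : AddCircle (2 * Real.pi))
  rw [hc] at this
  simp only [Pi.zero_apply, zero_smul] at this
  exact (this.unique hasSum_zero)

theorem hr_ode (L s0 : ℝ) (c : ℝ → ℝ) (hc : Continuous c) (m k : ℝ → ℂ)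
    (hm : ∀ s < L, HasDerivAt m (k s) s) (hk : ∀ s < L, HasDerivAt k (c s * m s) s)
    (h1 : m s0 = 0) (h2 : k s0 = 0) : ∀ s < L, s0 ≤ s → m s = 0 := by
  intro s1 hs1 hs01
  obtain ⟨C, hC⟩ := (isCompact_Icc (a := s0) (b := s1)).exists_bound_of_continuousOn hc.continuousOn
  have hC0 : 0 ≤ C := (norm_nonneg _).trans (hC s0 ⟨le_rfl, hs01⟩)
  have key := ODE_solution_unique_of_mem_Icc_right (a := s0) (b := s1)
    (v := fun t (y : ℂ × ℂ) => (y.2, (c t : ℂ) * y.1)) (s := fun _ => Set.univ)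
    (K := Real.toNNReal (max 1 C)) (f := fun t => (m t, k t)) (g := fun _ => 0) ?_ ?_ ?_
    (fun _ _ => trivial) continuousOn_const ?_ (fun _ _ => trivial) ?_
  · have := key (Set.right_mem_Icc.2 hs01)
    simpa using congrArg Prod.fst this
  · intro t ht
    refine LipschitzWith.lipschitzOnWith (LipschitzWith.of_dist_le_mul fun x y => ?_)
    rw [Real.coe_toNNReal _ (by positivity), Prod.dist_eq, Prod.dist_eq]
    simp only [dist_eq_norm, ← mul_sub, norm_mul]
    have hct := hC t (Set.Ico_subset_Icc_self ht)
    rw [Complex.norm_real]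
    have a1 : ‖x.1 - y.1‖ ≤ max ‖x.1 - y.1‖ ‖x.2 - y.2‖ := le_max_left _ _
    have a2 : ‖x.2 - y.2‖ ≤ max ‖x.1 - y.1‖ ‖x.2 - y.2‖ := le_max_right _ _
    have a3 : (1:ℝ) ≤ max 1 C := le_max_left _ _
    have a4 : C ≤ max 1 C := le_max_right _ _
    refine max_le ?_ ?_
    · calc ‖x.2 - y.2‖ ≤ 1 * max ‖x.1 - y.1‖ ‖x.2 - y.2‖ := by linarith
        _ ≤ _ := by gcongr
    · exact mul_le_mul (hct.trans a4) a1 (norm_nonneg _) (by positivity)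
  · intro t ht
    have := lt_of_le_of_lt ht.2 hs1
    exact ((hm t this).continuousAt.prodMk (hk t this).continuousAt).continuousWithinAt
  · intro t ht
    have := ht.2.trans hs1
    exact ((hm t this).prodMk (hk t this)).hasDerivWithinAt
  · intro t ht
    have := (hasDerivWithinAt_const t (Set.Ici t) (0 : ℂ × ℂ))
    convert this using 1
    simp
  · simp [h1, h2]

/-- `f` is a `C²` solution of the Helmholtz equation on `U`, with derivatives `F`, `G`. -/
structure HRSol (lam : ℝ) (U : Set ℂ) (f : ℂ → ℝ) (F : ℂ → ℂ →L[ℝ] ℝ)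
    (G : ℂ → ℂ →L[ℝ] ℂ →L[ℝ] ℝ) : Prop where
  d1 : ∀ z ∈ U, HasFDerivAt f (F z) z
  d2 : ∀ z ∈ U, HasFDerivAt F (G z) z
  cont : ContinuousOn G U
  eqn : ∀ z ∈ U, G z 1 1 + G z I I + lam ^ 2 * f z = 0

theorem hr_lap_rot (G : ℂ →L[ℝ] ℂ →L[ℝ] ℝ) (a : ℂ) :
    G a a + G (a * I) (a * I) = ‖a‖ ^ 2 * (G 1 1 + G I I) := by
  have h1 : a = a.re • (1:ℂ) + a.im • I := by
    simp
  have h2 : a * I = (-a.im) • (1:ℂ) + a.re • I := by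
    apply Complex.ext <;> simp
  rw [h2]
  nth_rewrite 1 2 [h1]
  simp only [map_add, map_smul, add_apply, smul_apply,
    smul_eq_mul]
  rw [Complex.sq_norm, Complex.normSq_apply]
  ring

set_option maxHeartbeats 2000000 in
theorem hr_disc {lam : ℝ} {p : ℂ} {R : ℝ} {f : ℂ → ℝ} {F : ℂ → ℂ →L[ℝ] ℝ}
    {G : ℂ → ℂ →L[ℝ] ℂ →L[ℝ] ℝ} (h : HRSol lam (Metric.ball p R) f F G) (hR : 0 < R)
    (h0 : ∀ᶠ z in nhds p, f z = 0) : ∀ z ∈ Metric.ball p R, f z = 0 := by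
  set L := Real.log R with hL
  set E : ℝ → ℝ → ℂ := fun s θ => exp (s + θ * I) with hE
  set P : ℝ → ℝ → ℂ := fun s θ => p + E s θ with hP
  have hEn : ∀ s θ, ‖E s θ‖ = Real.exp s := fun s θ => by
    simp [hE, Complex.norm_exp]
  have hmem : ∀ s < L, ∀ θ, P s θ ∈ Metric.ball p R := fun s hs θ => by
    rw [Metric.mem_ball, dist_eq_norm]
    simp only [hP, add_sub_cancel_left, hEn]
    exact (Real.lt_log_iff_exp_lt hR).1 hs
  -- derivatives of E, P
  have dEs : ∀ s θ, HasDerivAt (fun s => E s θ) (E s θ) s := fun s θ => by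
    have : HasDerivAt (fun s : ℝ => ((s:ℂ) + θ * I)) 1 s := (Complex.ofRealCLM.hasDerivAt).add_const _
    simpa [hE] using this.cexp
  have dEt : ∀ s θ, HasDerivAt (fun θ => E s θ) (E s θ * I) θ := fun s θ => by
    have : HasDerivAt (fun θ : ℝ => ((s:ℂ) + θ * I)) (1 * I) θ :=
      ((Complex.ofRealCLM.hasDerivAt).mul_const I).const_add _
    simpa [hE] using this.cexp
  have dPs : ∀ s θ, HasDerivAt (fun s => P s θ) (E s θ) s := fun s θ => (dEs s θ).const_add _
  have dPt : ∀ s θ, HasDerivAt (fun θ => P s θ) (E s θ * I) θ := fun s θ => (dEt s θ).const_add _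
  set W : ℝ → ℝ → ℝ := fun s θ => f (P s θ) with hW
  set W1 : ℝ → ℝ → ℝ := fun s θ => F (P s θ) (E s θ) with hW1
  set W2 : ℝ → ℝ → ℝ := fun s θ => G (P s θ) (E s θ) (E s θ) + F (P s θ) (E s θ) with hW2
  set T1 : ℝ → ℝ → ℝ := fun s θ => F (P s θ) (E s θ * I) with hT1
  set T2 : ℝ → ℝ → ℝ := fun s θ => G (P s θ) (E s θ * I) (E s θ * I) + F (P s θ) (E s θ * I * I)
    with hT2
  have dW : ∀ s < L, ∀ θ, HasDerivAt (fun s => W s θ) (W1 s θ) s := fun s hs θ =>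
    (h.d1 _ (hmem s hs θ)).comp_hasDerivAt s (dPs s θ)
  have dW1 : ∀ s < L, ∀ θ, HasDerivAt (fun s => W1 s θ) (W2 s θ) s := fun s hs θ =>
    ((h.d2 _ (hmem s hs θ)).comp_hasDerivAt s (dPs s θ)).clm_apply (dEs s θ)
  have dT : ∀ s < L, ∀ θ, HasDerivAt (fun θ => W s θ) (T1 s θ) θ := fun s hs θ =>
    (h.d1 _ (hmem s hs θ)).comp_hasDerivAt θ (dPt s θ)
  have dT1 : ∀ s < L, ∀ θ, HasDerivAt (fun θ => T1 s θ) (T2 s θ) θ := fun s hs θ =>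
    ((h.d2 _ (hmem s hs θ)).comp_hasDerivAt θ (dPt s θ)).clm_apply ((dEt s θ).mul_const I)
  have hpde : ∀ s < L, ∀ θ, W2 s θ = - T2 s θ - lam ^ 2 * Real.exp (2 * s) * W s θ := by
    intro s hs θ
    have e1 := hr_lap_rot (G (P s θ)) (E s θ)
    have e2 := h.eqn _ (hmem s hs θ)
    have e3 : E s θ * I * I = - E s θ := by rw [mul_assoc, I_mul_I]; ring
    have e4 : Real.exp (2 * s) = ‖E s θ‖ ^ 2 := by rw [hEn, ← Real.exp_nat_mul]; norm_num
    simp only [hW2, hT2, hW]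
    rw [e3, map_neg, e4]
    linear_combination e1 + ‖E s θ‖ ^ 2 * e2
  -- continuity
  have cE : Continuous (fun q : ℝ × ℝ => E q.1 q.2) := by simp only [hE]; fun_prop
  have cP : Continuous (fun q : ℝ × ℝ => P q.1 q.2) := by simp only [hP]; fun_prop
  have mP : Set.MapsTo (fun q : ℝ × ℝ => P q.1 q.2) (Set.Iio L ×ˢ Set.univ) (Metric.ball p R) :=
    fun q hq => hmem q.1 hq.1 q.2
  have cf : ContinuousOn f (Metric.ball p R) := fun z hz => (h.d1 z hz).continuousAt.continuousWithinAt
  have cF : ContinuousOn F (Metric.ball p R) := fun z hz => (h.d2 z hz).continuousAt.continuousWithinAt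
  have cW : ContinuousOn (fun q : ℝ × ℝ => W q.1 q.2) (Set.Iio L ×ˢ Set.univ) :=
    cf.comp cP.continuousOn mP
  have cFP := cF.comp cP.continuousOn mP
  have cGP := h.cont.comp cP.continuousOn mP
  have cW1 : ContinuousOn (fun q : ℝ × ℝ => W1 q.1 q.2) (Set.Iio L ×ˢ Set.univ) :=
    cFP.clm_apply cE.continuousOn
  have cW2 : ContinuousOn (fun q : ℝ × ℝ => W2 q.1 q.2) (Set.Iio L ×ˢ Set.univ) :=
    ((cGP.clm_apply cE.continuousOn).clm_apply cE.continuousOn).add cW1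
  have cEI : Continuous (fun q : ℝ × ℝ => E q.1 q.2 * I) := by fun_prop
  have cEII : Continuous (fun q : ℝ × ℝ => E q.1 q.2 * I * I) := by fun_prop
  have cT2 : ContinuousOn (fun q : ℝ × ℝ => T2 q.1 q.2) (Set.Iio L ×ˢ Set.univ) :=
    ((cGP.clm_apply cEI.continuousOn).clm_apply cEI.continuousOn).add
      (cFP.clm_apply cEII.continuousOn)
  have slice : ∀ {X : ℝ → ℝ → ℝ}, ContinuousOn (fun q : ℝ × ℝ => X q.1 q.2) (Set.Iio L ×ˢ Set.univ) →
      ∀ s < L, Continuous (X s) := fun {X} hX s hs => by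
    rw [← continuousOn_univ]
    exact hX.comp (f := fun θ : ℝ => (s, θ)) (by fun_prop) (fun θ _ => ⟨hs, trivial⟩)
  -- periodicity
  have pE : ∀ s θ, E s (θ + 2 * Real.pi) = E s θ := fun s θ => by
    simp only [hE]
    have : (s:ℂ) + ((θ + 2 * Real.pi : ℝ) : ℂ) * I = (s + θ * I) + 2 * Real.pi * I := by
      push_cast; ring
    rw [this, Complex.exp_periodic]
  have pP : ∀ s θ, P s (θ + 2 * Real.pi) = P s θ := fun s θ => by simp only [hP, pE]
  -- initial zero
  obtain ⟨ε, hε, hball⟩ := Metric.eventually_nhds_iff_ball.1 h0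
  have hF0 : ∀ z ∈ Metric.ball p ε, z ∈ Metric.ball p R → F z = 0 := by
    intro z hz hzR
    have h1 : f =ᶠ[nhds z] fun _ => 0 := by
      filter_upwards [Metric.isOpen_ball.mem_nhds hz] with y hy using hball y hy
    exact (h.d1 z hzR).unique ((hasFDerivAt_const (0:ℝ) z).congr_of_eventuallyEq h1)
  obtain ⟨s0, hs0⟩ : ∃ s0, s0 < min L (Real.log ε) := exists_lt _
  have hs0L : s0 < L := hs0.trans_le (min_le_left _ _)
  have hs0m : ∀ s ≤ s0, ∀ θ, P s θ ∈ Metric.ball p ε := fun s hs θ => by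
    rw [Metric.mem_ball, dist_eq_norm]
    simp only [hP, add_sub_cancel_left, hEn]
    exact (Real.lt_log_iff_exp_lt hε).1 (hs.trans_lt (hs0.trans_le (min_le_right _ _)))
  -- all Fourier coefficients vanish
  have hcoef : ∀ n : ℤ, ∀ s < L, s0 ≤ s →
      ∫ θ in (0:ℝ)..(2 * Real.pi), (W s θ : ℂ) * exp (-(n * I * θ)) = 0 := by
    intro n
    have cexpn : Continuous (fun θ : ℝ => exp (-(n * I * θ))) := by fun_prop
    have cexp2 : Continuous (fun q : ℝ × ℝ => exp (-(n * I * q.2))) := by fun_prop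
    have dexpn : ∀ θ : ℝ, HasDerivAt (fun θ : ℝ => exp (-(n * I * θ)))
        (exp (-(n * I * θ)) * (-(n * I))) θ := fun θ => by
      have : HasDerivAt (fun θ : ℝ => -(n * I * (θ:ℂ))) (-(n * I * 1)) θ :=
        ((Complex.ofRealCLM.hasDerivAt).const_mul (n * I : ℂ)).neg
      simpa using this.cexp
    refine hr_ode L s0 (fun s => (n:ℝ) ^ 2 - lam ^ 2 * Real.exp (2 * s)) (by fun_prop)
      (fun s => ∫ θ in (0:ℝ)..(2 * Real.pi), (W s θ : ℂ) * exp (-(n * I * θ)))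
      (fun s => ∫ θ in (0:ℝ)..(2 * Real.pi), (W1 s θ : ℂ) * exp (-(n * I * θ))) ?_ ?_ ?_ ?_
    · intro s hs
      refine hr_diff_int L (fun s θ => (W s θ : ℂ) * exp (-(n * I * θ)))
        (fun s θ => (W1 s θ : ℂ) * exp (-(n * I * θ))) ?_ ?_ ?_ s hs _ _
      · exact (Complex.continuous_ofReal.comp_continuousOn cW).mul cexp2.continuousOn
      · exact (Complex.continuous_ofReal.comp_continuousOn cW1).mul cexp2.continuousOn
      · exact fun s hs θ => ((dW s hs θ).ofReal_comp).mul_const _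
    · intro s hs
      have hd := hr_diff_int L (fun s θ => (W1 s θ : ℂ) * exp (-(n * I * θ)))
        (fun s θ => (W2 s θ : ℂ) * exp (-(n * I * θ)))
        ((Complex.continuous_ofReal.comp_continuousOn cW1).mul cexp2.continuousOn)
        ((Complex.continuous_ofReal.comp_continuousOn cW2).mul cexp2.continuousOn)
        (fun s hs θ => ((dW1 s hs θ).ofReal_comp).mul_const _) s hs 0 (2 * Real.pi)
      convert hd using 1
      have cWs := slice cW s hs
      have cTs := slice cT2 s hs
      have ftc := intervalIntegral.integral_eq_sub_of_hasDerivAt (a := 0) (b := 2 * Real.pi)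
        (f := fun θ => ((T1 s θ : ℂ) + n * I * W s θ) * exp (-(n * I * θ)))
        (f' := fun θ => ((T2 s θ : ℂ) + n ^ 2 * W s θ) * exp (-(n * I * θ)))
        (fun θ _ => by
          have := (((dT1 s hs θ).ofReal_comp).add
            (((dT s hs θ).ofReal_comp).const_mul (n * I : ℂ))).mul (dexpn θ)
          refine this.congr_deriv ?_
          simp only [Pi.add_apply]
          linear_combination (-(n:ℂ) ^ 2 * W s θ * exp (-(n * I * θ))) * I_sq)
        (Continuous.intervalIntegrable (by fun_prop) _ _)
      have hper : exp (-(n * I * ((2 * Real.pi : ℝ) : ℂ))) = 1 := by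
        rw [Complex.exp_eq_one_iff]
        exact ⟨-n, by push_cast; ring⟩
      have e1 : T1 s (2 * Real.pi) = T1 s 0 := by
        have a := pE s 0; have b := pP s 0
        rw [zero_add] at a b
        simp only [hT1, a, b]
      have e2 : W s (2 * Real.pi) = W s 0 := by
        have b := pP s 0
        rw [zero_add] at b
        simp only [hW, b]
      have ftc0 : ∫ θ in (0:ℝ)..(2 * Real.pi),
          ((T2 s θ : ℂ) + n ^ 2 * W s θ) * exp (-(n * I * θ)) = 0 := by
        rw [ftc, e1, e2, hper]; simp
      rw [← intervalIntegral.integral_const_mul]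
      rw [← add_zero (∫ θ in (0:ℝ)..(2 * Real.pi), (W2 s θ : ℂ) * exp (-(n * I * θ))), ← ftc0,
        ← intervalIntegral.integral_add]
      · refine intervalIntegral.integral_congr fun θ _ => ?_
        rw [hpde s hs θ]
        push_cast
        ring
      · have := slice cW2 s hs
        exact Continuous.intervalIntegrable (by fun_prop) _ _
      · exact Continuous.intervalIntegrable (by fun_prop) _ _
    · have : ∀ θ, W s0 θ = 0 := fun θ => hball _ (hs0m s0 le_rfl θ)
      simp [this]
    · have : ∀ θ, W1 s0 θ = 0 := fun θ => by
        simp only [hW1]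
        rw [hF0 _ (hs0m s0 le_rfl θ) (hmem s0 hs0L θ)]; simp
      simp [this]
  intro z hz
  by_cases hzε : z ∈ Metric.ball p ε
  · exact hball z hzε
  have hzp : z - p ≠ 0 := fun h => hzε (by
    rw [sub_eq_zero.1 h]; exact Metric.mem_ball_self hε)
  have hn : 0 < ‖z - p‖ := norm_pos_iff.2 hzp
  have hrep : P (Real.log ‖z - p‖) (Complex.arg (z - p)) = z := by
    have : E (Real.log ‖z - p‖) (Complex.arg (z - p)) = z - p := by
      have := Complex.exp_log hzp
      rw [Complex.log] at this
      exact this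
    simp only [hP, this]; ring
  have hs : Real.log ‖z - p‖ < L := Real.log_lt_log hn (by simpa [dist_eq_norm] using hz)
  have hs' : s0 ≤ Real.log ‖z - p‖ := by
    by_contra hlt
    have := hs0m _ (not_le.1 hlt).le (Complex.arg (z - p))
    rw [hrep] at this
    exact hzε this
  have hz0 := hr_fourier (fun θ => (W (Real.log ‖z - p‖) θ : ℂ))
    (Complex.continuous_ofReal.comp (slice cW _ hs)) (fun θ => by simp only [hW, pP])
    (fun n => hcoef n _ hs hs') (Complex.arg (z - p))
  have : W (Real.log ‖z - p‖) (Complex.arg (z - p)) = 0 := by exact_mod_cast hz0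
  simpa only [hW, hrep] using this

theorem HRSol.mono {lam : ℝ} {U V : Set ℂ} {f : ℂ → ℝ} {F : ℂ → ℂ →L[ℝ] ℝ}
    {G : ℂ → ℂ →L[ℝ] ℂ →L[ℝ] ℝ} (h : HRSol lam U f F G) (hV : V ⊆ U) : HRSol lam V f F G :=
  ⟨fun z hz => h.d1 z (hV hz), fun z hz => h.d2 z (hV hz), h.cont.mono hV,
    fun z hz => h.eqn z (hV hz)⟩

theorem hr_ucp {lam : ℝ} {U : Set ℂ} {f : ℂ → ℝ} {F : ℂ → ℂ →L[ℝ] ℝ}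
    {G : ℂ → ℂ →L[ℝ] ℂ →L[ℝ] ℝ} (h : HRSol lam U f F G) (hU : IsOpen U) (hc : IsPreconnected U)
    (p : ℂ) (hp : p ∈ U) (h0 : ∀ᶠ z in nhds p, f z = 0) : ∀ z ∈ U, f z = 0 := by
  have hsub : U ⊆ {z | ∀ᶠ y in nhds z, f y = 0} := by
    refine hc.subset_of_closure_inter_subset ?_ ⟨p, hp, h0⟩ ?_
    · exact isOpen_setOfPred_eventually_nhds
    · rintro q ⟨hq, hqU⟩
      obtain ⟨r, hr, hball⟩ := Metric.isOpen_iff.1 hU q hqU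
      obtain ⟨y, hy, hyd⟩ := Metric.mem_closure_iff.1 hq (r / 2) (by linarith)
      have hsubs : Metric.ball y (r / 2) ⊆ U := fun z hz => hball (by
        rw [Metric.mem_ball] at hz ⊢
        have := dist_triangle z y q
        rw [dist_comm] at hyd
        linarith)
      have := hr_disc (h.mono hsubs) (by linarith) hy
      filter_upwards [Metric.isOpen_ball.mem_nhds (show q ∈ Metric.ball y (r / 2) from hyd)]
        with z hz using this z hz
  exact fun z hz => (hsub hz).self_of_nhds

theorem hr_glue_deriv {X : Type*} [NormedAddCommGroup X] [NormedSpace ℝ X] {U : Set ℂ}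
    {f : ℂ → X} {F : ℂ → ℂ →L[ℝ] X} (h : ∀ z ∈ U, HasFDerivAt f (F z) z)
    (h0 : ∀ z ∈ U, z.im = 0 → f z = 0) (h1 : ∀ z ∈ U, z.im = 0 → F z = 0) :
    ∀ z ∈ U, HasFDerivAt (fun z => if 0 < z.im then f z else 0)
      (if 0 < z.im then F z else 0) z := by
  intro z hz
  rcases lt_trichotomy z.im 0 with hi | hi | hi
  · rw [if_neg hi.not_gt]
    refine (hasFDerivAt_const (0:X) z).congr_of_eventuallyEq ?_
    filter_upwards [(isOpen_lt Complex.continuous_im continuous_const).mem_nhds hi] with y hy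
    exact if_neg (not_lt.2 (le_of_lt hy))
  · have hd := h z hz
    rw [if_neg (by simp [hi])]
    rw [h1 z hz hi] at hd
    rw [hasFDerivAt_iff_isLittleO_nhds_zero] at hd ⊢
    refine Asymptotics.IsBigO.trans_isLittleO (Asymptotics.IsBigO.of_bound 1 ?_) hd
    refine Filter.Eventually.of_forall fun y => ?_
    have hz0 : (if 0 < z.im then f z else 0) = 0 := if_neg (by simp [hi])
    rw [hz0, h0 z hz hi]
    simp only [sub_zero, zero_apply, one_mul]
    split_ifs
    · exact le_rfl
    · simp
  · rw [if_pos hi]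
    refine (h z hz).congr_of_eventuallyEq ?_
    filter_upwards [(isOpen_lt continuous_const Complex.continuous_im).mem_nhds hi] with y hy
    exact if_pos hy

theorem hr_ite_tendsto {X : Type*} [NormedAddCommGroup X] (g : ℂ → X) (z : ℂ)
    (hc : Filter.Tendsto g (nhds z) (nhds 0)) :
    Filter.Tendsto (fun z => if 0 < z.im then g z else 0) (nhds z) (nhds 0) := by
  refine squeeze_zero_norm (fun y => ?_) (tendsto_zero_iff_norm_tendsto_zero.1 hc)
  split_ifs
  · exact le_rfl
  · simp

theorem hr_glue {lam : ℝ} {U : Set ℂ} {f : ℂ → ℝ} {F : ℂ → ℂ →L[ℝ] ℝ}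
    {G : ℂ → ℂ →L[ℝ] ℂ →L[ℝ] ℝ} (h : HRSol lam U f F G) (hU : IsOpen U)
    (h0 : ∀ z ∈ U, z.im = 0 → f z = 0) (h1 : ∀ z ∈ U, z.im = 0 → F z = 0) :
    HRSol lam U (fun z => if 0 < z.im then f z else 0) (fun z => if 0 < z.im then F z else 0)
      (fun z => if 0 < z.im then G z else 0) := by
  have h2 : ∀ z ∈ U, z.im = 0 → G z = 0 := by
    intro z hz hi
    have g1 : G z 1 = 0 := by
      have hl : HasDerivAt (fun t : ℝ => z + (t : ℂ)) 1 0 :=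
        (Complex.ofRealCLM.hasDerivAt).const_add z
      have hd : HasDerivAt (fun t : ℝ => F (z + (t : ℂ))) (G z 1) 0 :=
        HasFDerivAt.comp_hasDerivAt (0:ℝ) (f := fun t : ℝ => z + (t : ℂ)) (by simpa using h.d2 z hz) hl
      refine hd.unique ((hasDerivAt_const (0:ℝ) (0 : ℂ →L[ℝ] ℝ)).congr_of_eventuallyEq ?_)
      have : ∀ᶠ t : ℝ in nhds 0, z + (t : ℂ) ∈ U :=
        hl.continuousAt.eventually_mem (by simpa using hU.mem_nhds hz)
      filter_upwards [this] with t ht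
      exact h1 _ ht (by simp [hi])
    have hs := second_derivative_symmetric_of_eventually (𝕜 := ℝ)
      (by filter_upwards [hU.mem_nhds hz] with y hy using h.d1 y hy) (h.d2 z hz)
    have g2 : G z I 1 = 0 := by rw [hs, g1]; rfl
    have g3 : G z I I = 0 := by
      have := h.eqn z hz
      rw [g1, h0 z hz hi] at this
      simpa using this
    ext v w
    have hv : v = v.re • (1:ℂ) + v.im • I := by simp
    have hw : w = w.re • (1:ℂ) + w.im • I := by simp
    rw [hv, hw]
    simp only [map_add, map_smul, add_apply, smul_apply, smul_eq_mul, g1, g2, g3, zero_apply]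
    try simp
  refine ⟨hr_glue_deriv h.d1 h0 h1, hr_glue_deriv h.d2 h1 h2, ?_, ?_⟩
  · intro z hz
    have hc := h.cont.continuousAt (hU.mem_nhds hz)
    refine ContinuousAt.continuousWithinAt ?_
    rcases lt_trichotomy z.im 0 with hi | hi | hi
    · refine (continuousAt_const (y := (0 : ℂ →L[ℝ] ℂ →L[ℝ] ℝ))).congr ?_
      filter_upwards [(isOpen_lt Complex.continuous_im continuous_const).mem_nhds hi] with y hy
      exact (if_neg (not_lt.2 (le_of_lt hy))).symm
    · have hz0 : (if 0 < z.im then G z else 0) = 0 := if_neg (by simp [hi])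
      rw [ContinuousAt, h2 z hz hi] at hc
      rw [ContinuousAt, hz0]
      exact hr_ite_tendsto (X := ℂ →L[ℝ] ℂ →L[ℝ] ℝ) G z hc
    · refine hc.congr ?_
      filter_upwards [(isOpen_lt continuous_const Complex.continuous_im).mem_nhds hi] with y hy
      exact (if_pos hy).symm
  · intro z hz
    split_ifs
    · exact h.eqn z hz
    · simp

theorem hr_sol (lam : ℝ) (Ω : Set ℂ) (hΩ : IsOpen Ω) (u : ℂ → ℝ) (hu : ContDiffOn ℝ 2 u Ω)
    (hhelm : ∀ z ∈ Ω, lap u z + lam ^ 2 * u z = 0) :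
    HRSol lam Ω u (fderiv ℝ u) (fderiv ℝ (fderiv ℝ u)) := by
  have hF : ContDiffOn ℝ 1 (fderiv ℝ u) Ω := hu.fderiv_of_isOpen hΩ (by norm_num)
  have hG : ContDiffOn ℝ 0 (fderiv ℝ (fderiv ℝ u)) Ω := hF.fderiv_of_isOpen hΩ (by norm_num)
  have d1 : ∀ z ∈ Ω, HasFDerivAt u (fderiv ℝ u z) z := fun z hz =>
    ((hu.differentiableOn (by norm_num)).differentiableAt (hΩ.mem_nhds hz)).hasFDerivAt
  have d2 : ∀ z ∈ Ω, HasFDerivAt (fderiv ℝ u) (fderiv ℝ (fderiv ℝ u) z) z := fun z hz =>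
    ((hF.differentiableOn (by norm_num)).differentiableAt (hΩ.mem_nhds hz)).hasFDerivAt
  refine ⟨d1, d2, hG.continuousOn, ?_⟩
  have lx : ∀ z : ℂ, HasDerivAt (fun t : ℝ => z + (t : ℂ)) 1 0 := fun z =>
    (Complex.ofRealCLM.hasDerivAt).const_add z
  have ly : ∀ z : ℂ, HasDerivAt (fun t : ℝ => z + (t : ℂ) * I) I 0 := fun z => by
    simpa using ((Complex.ofRealCLM.hasDerivAt (x := 0)).mul_const I).const_add z
  have gx : ∀ (g : ℂ → ℝ) (g' : ℂ →L[ℝ] ℝ) (z : ℂ), HasFDerivAt g g' z → dx g z = g' 1 :=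
    fun g g' z hg => (HasFDerivAt.comp_hasDerivAt (0:ℝ) (f := fun t : ℝ => z + (t : ℂ))
      (by simpa using hg) (lx z)).deriv
  have gy : ∀ (g : ℂ → ℝ) (g' : ℂ →L[ℝ] ℝ) (z : ℂ), HasFDerivAt g g' z → dy g z = g' I :=
    fun g g' z hg => (HasFDerivAt.comp_hasDerivAt (0:ℝ) (f := fun t : ℝ => z + (t : ℂ) * I)
      (by simpa using hg) (ly z)).deriv
  intro z hz
  have e := hhelm z hz
  have app : ∀ v : ℂ, HasFDerivAt (fun y => fderiv ℝ u y v)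
      ((fderiv ℝ (fderiv ℝ u) z).flip v) z := fun v => by
    simpa using (d2 z hz).clm_apply (hasFDerivAt_const v z)
  have ex : dx (dx u) z = fderiv ℝ (fderiv ℝ u) z 1 1 := by
    rw [gx (dx u) ((fderiv ℝ (fderiv ℝ u) z).flip 1) z ((app 1).congr_of_eventuallyEq ?_)]
    · rfl
    · filter_upwards [hΩ.mem_nhds hz] with y hy using gx u _ y (d1 y hy)
  have ey : dy (dy u) z = fderiv ℝ (fderiv ℝ u) z I I := by
    rw [gy (dy u) ((fderiv ℝ (fderiv ℝ u) z).flip I) z ((app I).congr_of_eventuallyEq ?_)]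
    · rfl
    · filter_upwards [hΩ.mem_nhds hz] with y hy using gy u _ y (d1 y hy)
  rw [lap, ex, ey] at e
  exact e

theorem hr_refl {lam : ℝ} {U : Set ℂ} {f : ℂ → ℝ} {F : ℂ → ℂ →L[ℝ] ℝ}
    {G : ℂ → ℂ →L[ℝ] ℂ →L[ℝ] ℝ} (h : HRSol lam U f F G)
    (hsym : ∀ z ∈ U, (starRingEnd ℂ) z ∈ U) :
    ∃ G', HRSol lam U (fun z => f ((starRingEnd ℂ) z) - f z)
      (fun z => (F ((starRingEnd ℂ) z)).comp (conjCLE : ℂ →L[ℝ] ℂ) - F z) G' := by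
  let C : ℂ →L[ℝ] ℂ := conjCLE
  let A : (ℂ →L[ℝ] ℝ) →L[ℝ] (ℂ →L[ℝ] ℝ) := (ContinuousLinearMap.compL ℝ ℂ ℂ ℝ).flip C
  have hC : ∀ z, HasFDerivAt (fun z => (starRingEnd ℂ) z) C z := fun z => C.hasFDerivAt
  refine ⟨fun z => (A.comp (G ((starRingEnd ℂ) z))).comp C - G z, ?_, ?_, ?_, ?_⟩
  · intro z hz
    exact (HasFDerivAt.comp z (h.d1 _ (hsym z hz)) (hC z)).sub (h.d1 z hz)
  · intro z hz
    have h2 := HasFDerivAt.comp z (h.d2 _ (hsym z hz)) (hC z)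
    have h3 := (A.hasFDerivAt (x := F ((starRingEnd ℂ) z))).comp z h2
    exact h3.sub (h.d2 z hz)
  · have hc : ContinuousOn (fun z => G ((starRingEnd ℂ) z)) U :=
      h.cont.comp Complex.continuous_conj.continuousOn hsym
    exact ((continuousOn_const.clm_comp hc).clm_comp continuousOn_const).sub h.cont
  · intro z hz
    have e1 := h.eqn z hz
    have e2 := h.eqn _ (hsym z hz)
    simp only [sub_apply, ContinuousLinearMap.comp_apply, A, C, ContinuousLinearMap.flip_apply,
      ContinuousLinearMap.compL_apply, ContinuousLinearEquiv.coe_coe, conjCLE_apply, map_one,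
      conj_I, map_neg, neg_apply, neg_neg]
    linear_combination e2 - e1

/-- Symmetric reflection principle for the Helmholtz equation `Δu + λ²u = 0`
across the real axis with homogeneous Neumann data. -/
theorem helmholtz_neumann_reflection
    (lam : ℝ) (Ω : Set ℂ) (hΩ : IsOpen Ω) (hconn : IsConnected Ω)
    (hsym : ∀ z ∈ Ω, (starRingEnd ℂ) z ∈ Ω)
    (hreal : ∃ x : ℝ, (x : ℂ) ∈ Ω)
    (u : ℂ → ℝ) (hu : ContDiffOn ℝ 2 u Ω)
    (hhelm : ∀ z ∈ Ω, lap u z + lam ^ 2 * u z = 0)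
    (hneu : ∀ x : ℝ, (x : ℂ) ∈ Ω →
      deriv (fun t : ℝ => u ((x : ℂ) + (t : ℂ) * I)) 0 = 0) :
    ∀ z ∈ Ω, u ((starRingEnd ℂ) z) = u z := by
  have hS := hr_sol lam Ω hΩ u hu hhelm
  obtain ⟨G', hw⟩ := hr_refl hS hsym
  have real_conj : ∀ z : ℂ, z.im = 0 → (starRingEnd ℂ) z = z := fun z hz =>
    Complex.conj_eq_iff_im.2 hz
  have hg := hr_glue hw hΩ (fun z hz hi => by simp only [real_conj z hi, sub_self])
    (fun z hz hi => by
      simp only [real_conj z hi]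
      have hzr : z = (z.re : ℂ) := by apply Complex.ext <;> simp [hi]
      have hI : fderiv ℝ u z I = 0 := by
        have hn := hneu z.re (by rwa [← hzr])
        rw [← hzr] at hn
        have ly : HasDerivAt (fun t : ℝ => z + (t : ℂ) * I) I 0 := by
          simpa using ((Complex.ofRealCLM.hasDerivAt (x := 0)).mul_const I).const_add z
        rw [← hn]
        exact (HasFDerivAt.comp_hasDerivAt (0:ℝ) (f := fun t : ℝ => z + (t : ℂ) * I)
          (by simpa using hS.d1 z hz) ly).deriv.symm
      ext v
      have hv : v = v.re • (1:ℂ) + v.im • I := by simp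
      rw [hv]
      simp only [map_add, map_smul, sub_apply, ContinuousLinearMap.comp_apply,
        ContinuousLinearEquiv.coe_coe, conjCLE_apply, map_one, conj_I, map_neg, hI, zero_apply]
      simp)
  obtain ⟨x, hx⟩ := hreal
  obtain ⟨r, hr, hball⟩ := Metric.isOpen_iff.1 hΩ _ hx
  have hp : (x : ℂ) - (r / 2 : ℝ) * I ∈ Ω := hball (by
    rw [Metric.mem_ball, dist_eq_norm]
    simp [abs_of_pos hr]; linarith)
  have hzero := hr_ucp hg hΩ hconn.isPreconnected _ hp (by
    have him : ((x : ℂ) - (r / 2 : ℝ) * I).im < 0 := by simp; linarith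
    filter_upwards [(isOpen_lt Complex.continuous_im continuous_const).mem_nhds him] with y hy
    exact if_neg (not_lt.2 (le_of_lt hy)))
  intro z hz
  rcases lt_trichotomy z.im 0 with hi | hi | hi
  · have := hzero _ (hsym z hz)
    rw [if_pos (by simpa using hi), Complex.conj_conj] at this
    linarith
  · rw [real_conj z hi]
  · have := hzero z hz
    rw [if_pos hi] at this
    linarith
end
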